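/- (Analytic core of Theorem 4.1.) Assume A_0 > 0, α > κ_0/2, β ∈ (0,1), γ > 0, μ > 0, t > 0, and let L_0, L_1, …, L_n : (0,∞) → (0,∞) be measurable functions, slowly varying at infinity (L_j(ux)/L_j(x) → 1 as x → ∞ for every u > 0) and bounded on every finite interval. Define the spectral density f^{(L)}(λ) = ∑_{j=−n}^{n} (c_2(κ_j)/2) A_j (1 − θ_{κ_j}(|λ+w_j|)) L_j(1/|λ+w_j|) / |λ+w_j|^{1−κ_j}, where w_{−j} = −w_j, κ_{−j} = κ_j, A_{−j} = A_j, L_{−j} = L_j, c_2(κ_0) = 1/(Γ(κ_0) cos(πκ_0/2)), and c_2(κ_j) = 1/(2Γ(κ_j) cos(πκ_j/2)) for j ≠ 0. Then lim_{ε→0⁺} ∫_ℝ ( E_β(−μ|λ|^α (1 + λ² ε^{2β/α})^{γ/2} t^β) · ε^{(1−κ_0)β/(2α)} √( f^{(L)}(ε^{β/α} λ) / L_0(ε^{−β/α}) ) − √(A_0/(2 Γ(κ_0) cos(πκ_0/2))) · E_β(−μ t^β |λ|^α) |λ|^{(κ_0−1)/2} )² dλ = 0. (This integral is the mean-square distance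 E(U^{(L)}_ε(t,x) − U_0(t,x))² between the rescaled, slowly-varying-normalized solution of the fractional Riesz–Bessel equation and the limit Gaussian field; its vanishing yields the convergence of finite-dimensional distributions.) -/

import Mathlib

open Real Filter Topology MeasureTheory

/-- The Mittag-Leffler function `E_β(s) = ∑_{k=0}^∞ s^k / Γ(1 + βk)`. -/
noncomputable def mittagLeffler (β s : ℝ) : ℝ := ∑' k : ℕ, s ^ k / Real.Gamma (1 + β * k)

/-- The modified Bessel function of the second kind
`K_ν(z) = (1/2) ∫_0^∞ s^{ν−1} exp(−(z/2)(s + 1/s)) ds`. -/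
noncomputable def besselK (ν z : ℝ) : ℝ :=
  (1 / 2) * ∫ s in Set.Ioi (0 : ℝ), s ^ (ν - 1) * Real.exp (-(z / 2) * (s + 1 / s))

/-- `θ_κ(z) = 1 − (2^{(3−κ)/2} Γ(κ) cos(πκ/2)/(√π Γ(κ/2))) z^{(1−κ)/2} K_{(κ−1)/2}(z)`. -/
noncomputable def theta (κ z : ℝ) : ℝ :=
  1 - (2 : ℝ) ^ ((3 - κ) / 2) * Real.Gamma κ * Real.cos (Real.pi * κ / 2) /
      (Real.sqrt Real.pi * Real.Gamma (κ / 2)) * z ^ ((1 - κ) / 2) * besselK ((κ - 1) / 2) z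

/-- `c_2(κ_0) = 1/(Γ(κ_0)cos(πκ_0/2))` and `c_2(κ_j) = 1/(2Γ(κ_j)cos(πκ_j/2))` for `j ≠ 0`. -/
noncomputable def cTwo (κ : ℕ → ℝ) (j : ℤ) : ℝ :=
  if j = 0 then 1 / (Real.Gamma (κ 0) * Real.cos (Real.pi * κ 0 / 2))
  else 1 / (2 * Real.Gamma (κ j.natAbs) * Real.cos (Real.pi * κ j.natAbs / 2))

/-- The signed singularity location: `w_j` for `j > 0`, `0` for `j = 0`, `−w_{|j|}` for `j < 0`. -/
noncomputable def wSigned (w : ℕ → ℝ) (j : ℤ) : ℝ := (j.sign : ℝ) * w j.natAbs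

/-- The spectral density with slowly varying factors,
`f^{(L)}(λ) = ∑_{j=−n}^{n} (c_2(κ_j)/2) A_j (1 − θ_{κ_j}(|λ+w_j|)) L_j(1/|λ+w_j|)
  / |λ+w_j|^{1−κ_j}`, with `w_{−j} = −w_j`, `κ_{−j} = κ_j`, `A_{−j} = A_j`, `L_{−j} = L_j`. -/
noncomputable def specDensityL (n : ℕ) (w κ A : ℕ → ℝ) (L : ℕ → ℝ → ℝ) (lam : ℝ) : ℝ :=
  ∑ j ∈ Finset.Icc (-(n : ℤ)) (n : ℤ),
    cTwo κ j / 2 * A j.natAbs * (1 - theta (κ j.natAbs) |lam + wSigned w j|) *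
      L j.natAbs (1 / |lam + wSigned w j|) / |lam + wSigned w j| ^ (1 - κ j.natAbs)


/-! ### Slowly varying functions -/

theorem sv_unif (h : ℝ → ℝ) (hm : Measurable h)
    (hs : ∀ s : ℝ, Tendsto (fun t => h (t + s) - h t) atTop (𝓝 0)) :
    ∃ T : ℝ, ∀ t, T ≤ t → ∀ s ∈ Set.Icc (0:ℝ) 1, |h (t + s) - h t| ≤ 1 := by
  set J : ℝ → ℝ := fun t => ∫ s in (0:ℝ)..2, min 1 |h (t + s) - h t| with hJ
  have hmeas : ∀ t, Measurable (fun s => min 1 |h (t + s) - h t|) := by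
    intro t
    have h1 : Measurable (fun s => h (t + s)) := hm.comp (measurable_const_add t)
    exact measurable_const.min ((h1.sub_const _).abs)
  have hb : ∀ t s, ‖min 1 |h (t + s) - h t|‖ ≤ 1 := by
    intro t s
    rw [Real.norm_of_nonneg (le_min zero_le_one (abs_nonneg _))]
    exact min_le_left _ _
  have hitg : ∀ t a b, IntervalIntegrable (fun s => min 1 |h (t + s) - h t|) volume a b := by
    intro t a b
    refine (intervalIntegrable_const (c := (1:ℝ))).mono_fun (hmeas t).aestronglyMeasurable ?_
    exact Eventually.of_forall fun s => by simpa using hb t s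
  have hJ0 : Tendsto J atTop (𝓝 0) := by
    have : Tendsto J atTop (𝓝 (∫ s in (0:ℝ)..2, (0:ℝ))) := by
      refine intervalIntegral.tendsto_integral_filter_of_dominated_convergence (fun _ => 1)
        (Eventually.of_forall fun t => (hmeas t).aestronglyMeasurable)
        (Eventually.of_forall fun t => Eventually.of_forall fun s _ => hb t s)
        intervalIntegrable_const (Eventually.of_forall fun s _ => ?_)
      have h2 := (tendsto_const_nhds (x := (1:ℝ))).min (hs s).abs
      simpa using h2
    simpa using this
  have hnn : ∀ t s, 0 ≤ min 1 |h (t + s) - h t| := fun t s => le_min zero_le_one (abs_nonneg _)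
  have key : ∀ t, ∀ s ∈ Set.Icc (0:ℝ) 1, min 1 |h (t + s) - h t| ≤ J t + J (t + s) := by
    intro t s0 hs0
    have e1 : (∫ s in (1:ℝ)..2, min 1 |h (t + s0) - h t|) = min 1 |h (t + s0) - h t| := by
      rw [intervalIntegral.integral_const]; norm_num
    have e2 : (∫ s in (1:ℝ)..2, min 1 |h (t + s) - h t|) ≤ J t := by
      refine intervalIntegral.integral_mono_interval (by norm_num) (by norm_num) le_rfl ?_ (hitg t 0 2)
      exact Eventually.of_forall fun s => hnn t s
    have e3 : (∫ s in (1:ℝ)..2, min 1 |h (t + s0 + (s - s0)) - h (t + s0)|) ≤ J (t + s0) := by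
      rw [intervalIntegral.integral_comp_sub_right
        (fun s => min 1 |h (t + s0 + s) - h (t + s0)|) s0]
      refine intervalIntegral.integral_mono_interval (by linarith [hs0.2]) (by linarith)
        (by linarith [hs0.1]) ?_ (hitg _ 0 2)
      exact Eventually.of_forall fun s => hnn _ s
    have hitg2 : IntervalIntegrable (fun s => min 1 |h (t + s0 + (s - s0)) - h (t + s0)|)
        volume 1 2 := by
      have := (hitg (t + s0) (1 - s0) (2 - s0)).comp_sub_right s0
      simpa using this
    have e4 : (∫ s in (1:ℝ)..2, min 1 |h (t + s0) - h t|) ≤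
        ∫ s in (1:ℝ)..2, (min 1 |h (t + s) - h t| +
          min 1 |h (t + s0 + (s - s0)) - h (t + s0)|) := by
      refine intervalIntegral.integral_mono_on (by norm_num) intervalIntegrable_const
        ((hitg t 1 2).add hitg2) ?_
      intro s _
      have : t + s0 + (s - s0) = t + s := by ring
      rw [this]
      have h3 : |h (t + s0) - h t| ≤ |h (t + s) - h t| + |h (t + s) - h (t + s0)| := by
        have := abs_sub_le (h (t + s0)) (h (t + s)) (h t)
        rw [abs_sub_comm (h (t + s0)) (h (t+s))] at this
        linarith
      rcases le_total 1 |h (t + s) - h t| with h4 | h4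
      · rw [min_eq_left h4]
        have := min_le_left 1 |h (t + s0) - h t|
        have := le_min zero_le_one (abs_nonneg (h (t + s) - h (t + s0)))
        linarith
      · rw [min_eq_right h4]
        rcases le_total 1 |h (t + s) - h (t + s0)| with h5 | h5
        · rw [min_eq_left h5]
          have := min_le_left 1 |h (t + s0) - h t|
          have := abs_nonneg (h (t + s) - h t)
          linarith
        · rw [min_eq_right h5]
          exact (min_le_right _ _).trans h3
    rw [intervalIntegral.integral_add (hitg t 1 2) hitg2] at e4
    linarith
  have hev : ∀ᶠ t in atTop, J t < 1/4 := hJ0.eventually (gt_mem_nhds (by norm_num))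
  obtain ⟨T, hT⟩ := eventually_atTop.1 hev
  refine ⟨T, fun t ht s hs0 => ?_⟩
  have h1 := key t s hs0
  have h2 := hT t ht
  have h3 := hT (t + s) (by linarith [hs0.1])
  by_contra hc
  push Not at hc
  rw [min_eq_left hc.le] at h1
  linarith

theorem sv_potter_add (h : ℝ → ℝ) (hm : Measurable h)
    (hs : ∀ s : ℝ, Tendsto (fun t => h (t + s) - h t) atTop (𝓝 0)) (η : ℝ) (hη : 0 < η) :
    ∃ T : ℝ, ∀ t, T ≤ t → ∀ s, 0 ≤ s → |h (t + s) - h t| ≤ η * s + 1 := by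
  obtain ⟨T, hT⟩ := sv_unif h hm hs
  have hev : ∀ᶠ t in atTop, |h (t + 1) - h t| < η := by
    have := (hs 1).abs
    rw [abs_zero] at this
    exact this.eventually (gt_mem_nhds hη)
  obtain ⟨T', hT'⟩ := eventually_atTop.1 hev
  have hind : ∀ m : ℕ, ∀ t, T' ≤ t → |h (t + m) - h t| ≤ η * m := by
    intro m
    induction m with
    | zero => intro t _; simp
    | succ m ih =>
      intro t ht
      have h1 := ih t ht
      have h2 := hT' (t + m) (by have : (0:ℝ) ≤ m := Nat.cast_nonneg m; linarith)
      have h3 := abs_sub_le (h (t + m + 1)) (h (t + m)) (h t)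
      push_cast
      rw [← add_assoc]
      linarith
  refine ⟨max T T', fun t ht s hs0 => ?_⟩
  have hfl := Nat.floor_le hs0
  have hfl2 := Nat.lt_floor_add_one s
  have hn0 : (0:ℝ) ≤ (⌊s⌋₊ : ℝ) := Nat.cast_nonneg _
  have h1 := hind ⌊s⌋₊ t ((le_max_right _ _).trans ht)
  have h2 := hT (t + ⌊s⌋₊) (by have := (le_max_left T T').trans ht; linarith) (s - ⌊s⌋₊)
    ⟨by linarith, by linarith⟩
  have e : t + ⌊s⌋₊ + (s - ⌊s⌋₊) = t + s := by ring
  rw [e] at h2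
  have h3 := abs_sub_le (h (t + s)) (h (t + ⌊s⌋₊)) (h t)
  have h4 : η * (⌊s⌋₊ : ℝ) ≤ η * s := mul_le_mul_of_nonneg_left hfl hη.le
  linarith

theorem sv_potter (L : ℝ → ℝ) (hm : Measurable L) (hpos : ∀ x : ℝ, 0 < x → 0 < L x)
    (hslow : ∀ u : ℝ, 0 < u → Tendsto (fun x : ℝ => L (u * x) / L x) atTop (𝓝 1))
    (η : ℝ) (hη : 0 < η) :
    ∃ X : ℝ, 1 ≤ X ∧ ∀ x y, X ≤ x → X ≤ y →
      L y ≤ Real.exp 1 * L x * ((y / x) ^ η + (x / y) ^ η) := by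
  set h : ℝ → ℝ := fun t => Real.log (L (Real.exp t)) with hh
  have hhm : Measurable h := Real.measurable_log.comp (hm.comp Real.measurable_exp)
  have hs : ∀ s : ℝ, Tendsto (fun t => h (t + s) - h t) atTop (𝓝 0) := by
    intro s
    have h1 := (hslow (Real.exp s) (Real.exp_pos s)).comp Real.tendsto_exp_atTop
    have h2 := h1.log one_ne_zero
    rw [Real.log_one] at h2
    refine h2.congr fun t => ?_
    simp only [Function.comp, hh]
    rw [Real.log_div (hpos _ (by positivity)).ne' (hpos _ (by positivity)).ne', add_comm t s,
      Real.exp_add]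
  obtain ⟨T, hT⟩ := sv_potter_add h hhm hs η hη
  have hT2 : ∀ a b, T ≤ a → T ≤ b → |h b - h a| ≤ η * |b - a| + 1 := by
    intro a b ha hb
    rcases le_total a b with hab | hab
    · have := hT a ha (b - a) (by linarith)
      rw [abs_of_nonneg (sub_nonneg.2 hab)]
      simpa using this
    · have := hT b hb (a - b) (by linarith)
      rw [abs_sub_comm, abs_sub_comm b a, abs_of_nonneg (sub_nonneg.2 hab)]
      simpa using this
  refine ⟨max 1 (Real.exp T), le_max_left _ _, fun x y hx hy => ?_⟩
  have hx0 : 0 < x := lt_of_lt_of_le one_pos ((le_max_left _ _).trans hx)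
  have hy0 : 0 < y := lt_of_lt_of_le one_pos ((le_max_left _ _).trans hy)
  have hTx : T ≤ Real.log x := (Real.le_log_iff_exp_le hx0).2 ((le_max_right _ _).trans hx)
  have hTy : T ≤ Real.log y := (Real.le_log_iff_exp_le hy0).2 ((le_max_right _ _).trans hy)
  have h1 := hT2 _ _ hTx hTy
  have h2 : Real.log (L y) - Real.log (L x) ≤ η * |Real.log y - Real.log x| + 1 := by
    have := (le_abs_self _).trans h1
    simpa only [hh, Real.exp_log hx0, Real.exp_log hy0] using this
  have hLx := hpos x hx0
  have hLy := hpos y hy0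
  have h3 : L y ≤ Real.exp 1 * L x * Real.exp (η * |Real.log y - Real.log x|) := by
    rw [show L y = Real.exp (Real.log (L y)) by rw [Real.exp_log hLy]]
    rw [show Real.exp 1 * L x = Real.exp 1 * Real.exp (Real.log (L x)) by rw [Real.exp_log hLx]]
    rw [← Real.exp_add, ← Real.exp_add]
    exact Real.exp_le_exp.2 (by linarith)
  refine h3.trans (mul_le_mul_of_nonneg_left ?_ (by positivity))
  rw [Real.rpow_def_of_pos (div_pos hy0 hx0), Real.rpow_def_of_pos (div_pos hx0 hy0),
    Real.log_div hy0.ne' hx0.ne', Real.log_div hx0.ne' hy0.ne']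
  rcases abs_cases (Real.log y - Real.log x) with ⟨h, _⟩ | ⟨h, _⟩
  · rw [h, mul_comm]
    linarith [Real.exp_pos ((Real.log x - Real.log y) * η)]
  · rw [h, mul_comm, neg_sub]
    linarith [Real.exp_pos ((Real.log y - Real.log x) * η)]

/-! ### The Mittag-Leffler function -/

theorem gamma_ratio (β y : ℝ) (hβ : 0 < β) (hy : 1 < y) :
    Real.Gamma y * (y - 1) ^ β ≤ Real.Gamma (y + β) := by
  have h := Real.convexOn_log_Gamma.slope_mono_adjacent (x := y - 1) (y := y) (z := y + β)
    (Set.mem_Ioi.2 (by linarith)) (Set.mem_Ioi.2 (by linarith)) (by linarith) (by linarith)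
  simp only [Function.comp] at h
  have h0 : 0 < Real.Gamma (y - 1) := Real.Gamma_pos_of_pos (by linarith)
  have h1 : 0 < Real.Gamma y := Real.Gamma_pos_of_pos (by linarith)
  have h2 : 0 < Real.Gamma (y + β) := Real.Gamma_pos_of_pos (by linarith)
  have e : Real.Gamma y = (y - 1) * Real.Gamma (y - 1) := by
    have := Real.Gamma_add_one (s := y - 1) (by linarith)
    rwa [sub_add_cancel] at this
  have e2 : Real.log (Real.Gamma y) - Real.log (Real.Gamma (y - 1)) = Real.log (y - 1) := by
    rw [e, Real.log_mul (by linarith) h0.ne']; ring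
  rw [e2, show y - (y - 1) = 1 by ring, div_one, show y + β - y = β by ring, le_div_iff₀ hβ] at h
  rw [← Real.log_le_log_iff (mul_pos h1 (Real.rpow_pos_of_pos (by linarith) _)) h2,
    Real.log_mul h1.ne' (Real.rpow_pos_of_pos (by linarith) _).ne',
    Real.log_rpow (by linarith)]
  linarith

/-- Two-parameter Mittag-Leffler function. -/
noncomputable def mlG (β q x : ℝ) : ℝ := ∑' k : ℕ, x ^ k / Real.Gamma (β * k + q)

theorem mlG_summable (β q x : ℝ) (hβ : 0 < β) (hq : 0 < q) :
    Summable (fun k : ℕ => x ^ k / Real.Gamma (β * k + q)) := by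
  refine summable_of_ratio_norm_eventually_le (r := 1/2) (by norm_num) ?_
  have h1 : Tendsto (fun k : ℕ => (β * (k:ℝ) + q - 1) ^ β) atTop atTop := by
    refine (tendsto_rpow_atTop hβ).comp ?_
    have : Tendsto (fun k : ℕ => β * (k:ℝ)) atTop atTop :=
      tendsto_natCast_atTop_atTop.const_mul_atTop hβ
    have := tendsto_atTop_add_const_right atTop (q - 1) this
    refine this.congr fun k => by ring
  have h2 : Tendsto (fun k : ℕ => β * (k:ℝ) + q) atTop atTop :=
    tendsto_atTop_add_const_right atTop q (tendsto_natCast_atTop_atTop.const_mul_atTop hβ)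
  filter_upwards [h1.eventually_ge_atTop (2 * |x|), h2.eventually_gt_atTop 1] with k hk1 hk2
  have hg := gamma_ratio β _ hβ hk2
  have h0 : 0 < Real.Gamma (β * k + q) := Real.Gamma_pos_of_pos (by linarith)
  have h0' : 0 < Real.Gamma (β * k + q + β) := Real.Gamma_pos_of_pos (by linarith)
  rw [norm_div, norm_div, norm_pow, norm_pow]
  have e : β * ((k + 1 : ℕ) : ℝ) + q = β * k + q + β := by push_cast; ring
  rw [e, Real.norm_of_nonneg h0.le, Real.norm_of_nonneg h0'.le, Real.norm_eq_abs, pow_succ,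
    ← mul_div_assoc, div_le_div_iff₀ h0' h0]
  have h3 : Real.Gamma (β * k + q) * (2 * |x|) ≤ Real.Gamma (β * k + q + β) :=
    (mul_le_mul_of_nonneg_left hk1 h0.le).trans hg
  have := mul_le_mul_of_nonneg_left h3 (pow_nonneg (abs_nonneg x) k)
  linarith

theorem mlG_continuous (β q : ℝ) (hβ : 0 < β) (hq : 0 < q) : Continuous (mlG β q) := by
  rw [continuous_iff_continuousAt]
  intro x
  have hc : ContinuousOn (mlG β q) (Set.Icc (x - 1) (x + 1)) := by
    refine continuousOn_tsum (u := fun k : ℕ => (|x| + 1) ^ k / Real.Gamma (β * k + q))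
      (fun k => by fun_prop) (mlG_summable β q _ hβ hq) ?_
    intro k y hy
    have h0 : 0 < Real.Gamma (β * k + q) := Real.Gamma_pos_of_pos (by positivity)
    rw [norm_div, norm_pow, Real.norm_of_nonneg h0.le]
    gcongr
    rw [Real.norm_eq_abs, abs_le]
    constructor <;> linarith [hy.1, hy.2, neg_abs_le x, le_abs_self x]
  exact hc.continuousAt (Icc_mem_nhds (by linarith) (by linarith))

theorem mlG_shift (β q x : ℝ) (hβ : 0 < β) (hq : 0 < q) :
    mlG β q x = 1 / Real.Gamma q + x * mlG β (β + q) x := by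
  unfold mlG
  rw [(mlG_summable β q x hβ hq).tsum_eq_zero_add, ← tsum_mul_left]
  congr 1
  · simp
  · refine tsum_congr fun k => ?_
    rw [show β * ((k + 1 : ℕ) : ℝ) + q = β * k + (β + q) by push_cast; ring, pow_succ]
    ring

theorem real_beta (p m t : ℝ) (hp : 0 < p) (hm : 0 < m) (ht : 0 < t) :
    ∫ s in (0:ℝ)..t, (t - s) ^ (p - 1) * s ^ (m - 1) =
      Real.Gamma p * Real.Gamma m / Real.Gamma (p + m) * t ^ (p + m - 1) := by
  have h := Complex.betaIntegral_scaled (m : ℂ) (p : ℂ) ht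
  rw [Complex.betaIntegral_eq_Gamma_mul_div _ _ (by simpa using hm) (by simpa using hp)] at h
  have e1 : (∫ x in (0:ℝ)..t, (x : ℂ) ^ ((m:ℂ) - 1) * ((t : ℂ) - x) ^ ((p:ℂ) - 1)) =
      ((∫ s in (0:ℝ)..t, (t - s) ^ (p - 1) * s ^ (m - 1) : ℝ) : ℂ) := by
    rw [← intervalIntegral.integral_ofReal]
    refine intervalIntegral.integral_congr fun s hs => ?_
    rw [Set.uIcc_of_le ht.le] at hs
    rw [Complex.ofReal_mul, Complex.ofReal_cpow hs.1, Complex.ofReal_cpow (by linarith [hs.2])]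
    push_cast
    ring
  rw [e1, ← Complex.ofReal_add, Complex.Gamma_ofReal, Complex.Gamma_ofReal, Complex.Gamma_ofReal,
    show (((m + p : ℝ) : ℂ) - 1) = ((m + p - 1 : ℝ) : ℂ) by push_cast; ring,
    ← Complex.ofReal_cpow ht.le] at h
  have h' : (∫ s in (0:ℝ)..t, (t - s) ^ (p - 1) * s ^ (m - 1)) =
    t ^ (m + p - 1) * (Real.Gamma m * Real.Gamma p / Real.Gamma (m + p)) := by exact_mod_cast h
  rw [h', add_comm m p]
  ring

theorem real_beta_int (p m t : ℝ) (hp : 0 < p) (hm : 0 < m) (ht : 0 < t) :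
    IntervalIntegrable (fun s => (t - s) ^ (p - 1) * s ^ (m - 1)) volume 0 t := by
  by_contra hc
  have h := intervalIntegral.integral_undef hc
  rw [real_beta p m t hp hm ht] at h
  have h1 := Real.Gamma_pos_of_pos hp
  have h2 := Real.Gamma_pos_of_pos hm
  have h3 := Real.Gamma_pos_of_pos (add_pos hp hm)
  have : 0 < Real.Gamma p * Real.Gamma m / Real.Gamma (p + m) * t ^ (p + m - 1) := by positivity
  linarith

theorem mlG_integrable (β p q t : ℝ) (hβ : 0 < β) (hp : 0 < p) (hq : 0 < q) (ht : 0 < t) :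
    IntervalIntegrable (fun s => (t - s) ^ (p - 1) * (s ^ (q - 1) * mlG β q (-(s ^ β))))
      volume 0 t := by
  have h := (real_beta_int p q t hp hq ht).mul_continuousOn
    (g := fun s => mlG β q (-(s ^ β))) ?_
  · refine h.congr (fun s _ => by ring)
  · refine Continuous.continuousOn ?_
    exact (mlG_continuous β q hβ hq).comp (continuous_neg.comp (Real.continuous_rpow_const hβ.le))

theorem mlG_integral (β p q t : ℝ) (hβ : 0 < β) (hp : 0 < p) (hq : 0 < q) (ht : 0 < t) :
    ∫ s in (0:ℝ)..t, (t - s) ^ (p - 1) * (s ^ (q - 1) * mlG β q (-(s ^ β))) =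
      Real.Gamma p * (t ^ (p + q - 1) * mlG β (p + q) (-(t ^ β))) := by
  set F : ℕ → ℝ → ℝ := fun k s => ((-1) ^ k / Real.Gamma (β * k + q)) *
    ((t - s) ^ (p - 1) * s ^ (β * k + q - 1)) with hF
  have hitg : ∀ k, Integrable (F k) (volume.restrict (Set.Ioc 0 t)) := by
    intro k
    have := (real_beta_int p (β * k + q) t hp (by positivity) ht).1
    exact this.const_mul _
  have hbeta : ∀ k : ℕ, ∫ s in Set.Ioc 0 t, (t - s) ^ (p - 1) * s ^ (β * k + q - 1) =
      Real.Gamma p * Real.Gamma (β * k + q) / Real.Gamma (p + (β * k + q)) *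
        t ^ (p + (β * k + q) - 1) := by
    intro k
    rw [← real_beta p (β * k + q) t hp (by positivity) ht, intervalIntegral.integral_of_le ht.le]
  have hGpos : ∀ k : ℕ, 0 < Real.Gamma (β * k + q) :=
    fun k => Real.Gamma_pos_of_pos (by positivity)
  have hpow : ∀ k : ℕ, t ^ (p + (β * k + q) - 1) = t ^ (p + q - 1) * (t ^ β) ^ k := by
    intro k
    rw [← Real.rpow_natCast (t ^ β) k, ← Real.rpow_mul ht.le, ← Real.rpow_add ht]
    congr 1; ring
  have hterm : ∀ k : ℕ, ∫ s in Set.Ioc 0 t, F k s =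
      Real.Gamma p * t ^ (p + q - 1) * ((-(t ^ β)) ^ k / Real.Gamma (β * k + (p + q))) := by
    intro k
    simp only [hF]
    rw [integral_const_mul, hbeta, hpow, neg_pow (t ^ β) k,
      show p + (β * k + q) = β * k + (p + q) by ring]
    have := (hGpos k).ne'
    field_simp
  have hnorm : ∀ k : ℕ, ∫ s in Set.Ioc 0 t, ‖F k s‖ =
      Real.Gamma p * t ^ (p + q - 1) * ((t ^ β) ^ k / Real.Gamma (β * k + (p + q))) := by
    intro k
    have : ∫ s in Set.Ioc 0 t, ‖F k s‖ = ∫ s in Set.Ioc 0 t, (1 / Real.Gamma (β * k + q)) *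
        ((t - s) ^ (p - 1) * s ^ (β * k + q - 1)) := by
      refine setIntegral_congr_fun measurableSet_Ioc fun s hs => ?_
      have h1 : 0 ≤ (t - s) ^ (p - 1) * s ^ (β * k + q - 1) :=
        mul_nonneg (Real.rpow_nonneg (by linarith [hs.2]) _) (Real.rpow_nonneg hs.1.le _)
      simp only [hF]
      rw [norm_mul, Real.norm_of_nonneg h1, norm_div, norm_pow, norm_neg, norm_one, one_pow,
        Real.norm_of_nonneg (hGpos k).le]
    rw [this, integral_const_mul, hbeta, hpow, show p + (β * k + q) = β * k + (p + q) by ring]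
    have := (hGpos k).ne'
    field_simp
  have hsum : Summable fun k => ∫ s in Set.Ioc 0 t, ‖F k s‖ := by
    simp_rw [hnorm]
    exact (mlG_summable β (p + q) _ hβ (by positivity)).mul_left _
  have hs := hasSum_integral_of_summable_integral_norm hitg hsum
  have hs2 := hs.tsum_eq
  simp_rw [hterm] at hs2
  rw [tsum_mul_left] at hs2
  rw [intervalIntegral.integral_of_le ht.le, ← mul_assoc]
  unfold mlG
  rw [hs2]
  refine setIntegral_congr_fun measurableSet_Ioc fun s hs => ?_
  rw [← tsum_mul_left, ← tsum_mul_left]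
  refine tsum_congr fun k => ?_
  simp only [hF]
  have : s ^ (β * k + q - 1) = s ^ (q - 1) * (s ^ β) ^ k := by
    rw [← Real.rpow_natCast (s ^ β) k, ← Real.rpow_mul hs.1.le, ← Real.rpow_add hs.1]
    congr 1; ring
  rw [this, neg_pow (s ^ β) k]
  ring

theorem mlG_pos (β : ℝ) (hβ : β ∈ Set.Ioo (0:ℝ) 1) (T : ℝ) (hT : 0 ≤ T) :
    0 < mlG β β (-(T ^ β)) := by
  obtain ⟨hβ0, hβ1⟩ := hβ
  by_contra hneg
  push Not at hneg
  set g : ℝ → ℝ := fun t => mlG β β (-(t ^ β)) with hg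
  have hgc : Continuous g :=
    (mlG_continuous β β hβ0 hβ0).comp (continuous_neg.comp (Real.continuous_rpow_const hβ0.le))
  have hΓ : 0 < Real.Gamma β := Real.Gamma_pos_of_pos hβ0
  have hg0 : 0 < g 0 := by
    simp only [hg]
    rw [mlG_shift β β _ hβ0 hβ0, Real.zero_rpow hβ0.ne']
    simp [hΓ]
  set S : Set ℝ := Set.Icc 0 T ∩ g ⁻¹' Set.Iic 0 with hS
  have hScomp : IsCompact S := isCompact_Icc.inter_right (isClosed_Iic.preimage hgc)
  have hSne : S.Nonempty := ⟨T, ⟨hT, le_rfl⟩, hneg⟩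
  obtain ⟨t0, ht0⟩ := hScomp.exists_isLeast hSne
  have ht0g : g t0 ≤ 0 := ht0.1.2
  have ht00 : 0 < t0 := by
    rcases ht0.1.1.1.lt_or_eq with h | h
    · exact h
    · rw [← h] at ht0g; linarith
  have hpos : ∀ s, 0 ≤ s → s < t0 → 0 < g s := by
    intro s hs hst
    by_contra hc
    push Not at hc
    have := ht0.2 ⟨⟨hs, hst.le.trans ht0.1.1.2⟩, hc⟩
    linarith
  set v : ℝ → ℝ := fun t => t ^ (β - 1) * g t with hv
  have hI : ∀ t, 0 < t → ∫ s in (0:ℝ)..t, (t - s) ^ (β - 1) * v s =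
      t ^ (β - 1) - Real.Gamma β * v t := by
    intro t ht
    have h1 := mlG_integral β β β t hβ0 hβ0 hβ0 ht
    have h2 := mlG_shift β β (-(t ^ β)) hβ0 hβ0
    simp only [hv, hg]
    rw [h1, h2, show β + β - 1 = (β - 1) + β by ring, Real.rpow_add ht]
    field_simp
    ring
  have hitg : ∀ t, 0 < t → IntervalIntegrable (fun s => (t - s) ^ (β - 1) * v s) volume 0 t :=
    fun t ht => mlG_integrable β β β t hβ0 hβ0 hβ0 ht
  -- choose t1 close to t0
  have hlim : Tendsto (fun t => (t0 - t) ^ β / β) (𝓝[<] t0) (𝓝 0) := by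
    have hc : Continuous (fun t : ℝ => (t0 - t) ^ β / β) :=
      ((Real.continuous_rpow_const hβ0.le).comp (continuous_const.sub continuous_id)).div_const _
    have := hc.tendsto t0
    simp only [sub_self, Real.zero_rpow hβ0.ne', zero_div] at this
    exact this.mono_left nhdsWithin_le_nhds
  have hev1 : ∀ᶠ t in 𝓝[<] t0, (t0 - t) ^ β / β < Real.Gamma β / 2 :=
    hlim.eventually (gt_mem_nhds (by positivity))
  have hev2 : ∀ᶠ t in 𝓝[<] t0, t ∈ Set.Ioo (t0 / 2) t0 := Ioo_mem_nhdsLT (by linarith)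
  obtain ⟨t1, ht1a, ht1b⟩ := (hev1.and hev2).exists
  have hvc : ContinuousOn v (Set.Icc t1 t0) := by
    refine ContinuousOn.mul ?_ hgc.continuousOn
    intro x hx
    exact (Real.continuousAt_rpow_const _ _
      (Or.inl (by linarith [hx.1, ht1b.1]))).continuousWithinAt
  obtain ⟨t, htm, htmax⟩ := isCompact_Icc.exists_isMaxOn
    (Set.nonempty_Icc.2 ht1b.2.le) hvc
  have htpos : 0 < t := by linarith [htm.1, ht1b.1]
  have hvt1 : 0 < v t1 :=
    mul_pos (Real.rpow_pos_of_pos (by linarith [ht1b.1]) _)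
      (hpos t1 (by linarith [ht1b.1]) ht1b.2)
  have hvt : 0 < v t := hvt1.trans_le (htmax ⟨le_rfl, ht1b.2.le⟩)
  have htlt : t < t0 := by
    rcases htm.2.lt_or_eq with h | h
    · exact h
    · exfalso
      have : v t0 ≤ 0 := mul_nonpos_of_nonneg_of_nonpos (Real.rpow_nonneg ht00.le _) ht0g
      rw [h] at hvt; linarith
  -- split the integral at t
  have hsub1 : IntervalIntegrable (fun s => (t0 - s) ^ (β - 1) * v s) volume 0 t :=
    (hitg t0 ht00).mono_set (by
      rw [Set.uIcc_of_le htpos.le, Set.uIcc_of_le ht00.le]; exact Set.Icc_subset_Icc_right htlt.le)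
  have hsub2 : IntervalIntegrable (fun s => (t0 - s) ^ (β - 1) * v s) volume t t0 :=
    (hitg t0 ht00).mono_set (by
      rw [Set.uIcc_of_le htlt.le, Set.uIcc_of_le ht00.le]; exact Set.Icc_subset_Icc_left htpos.le)
  have hsplit := intervalIntegral.integral_add_adjacent_intervals hsub1 hsub2
  have hI0 := hI t0 ht00
  have hv0 : v t0 ≤ 0 := mul_nonpos_of_nonneg_of_nonpos (Real.rpow_nonneg ht00.le _) ht0g
  have hle1 : ∫ s in (0:ℝ)..t, (t0 - s) ^ (β - 1) * v s ≤
      ∫ s in (0:ℝ)..t, (t0 / t) ^ (β - 1) * ((t - s) ^ (β - 1) * v s) := by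
    refine intervalIntegral.integral_mono_on_of_le_Ioo htpos.le hsub1
      ((hitg t htpos).const_mul _) ?_
    intro s hs
    have hvs : 0 ≤ v s := (mul_pos (Real.rpow_pos_of_pos hs.1 _)
      (hpos s hs.1.le (hs.2.trans htlt))).le
    rw [← mul_assoc ((t0 / t) ^ (β - 1))]
    refine mul_le_mul_of_nonneg_right ?_ hvs
    have hts : 0 < t - s := by linarith [hs.2]
    rw [← Real.mul_rpow (by positivity) hts.le]
    refine Real.rpow_le_rpow_of_nonpos (by positivity) ?_ (by linarith)
    rw [div_mul_eq_mul_div, div_le_iff₀ htpos]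
    nlinarith [hs.1]
  rw [intervalIntegral.integral_const_mul, hI t htpos] at hle1
  have hle2 : ∫ s in t..t0, (t0 - s) ^ (β - 1) * v s ≤
      ∫ s in t..t0, (t0 - s) ^ (β - 1) * v t := by
    have hi : IntervalIntegrable (fun s => (t0 - s) ^ (β - 1)) volume t t0 := by
      have := (intervalIntegral.intervalIntegrable_rpow' (a := t0 - t) (b := t0 - t0)
        (r := β - 1) (by linarith)).comp_sub_left t0
      simpa using this
    refine intervalIntegral.integral_mono_on htlt.le hsub2 (hi.mul_const _) ?_
    intro s hs
    refine mul_le_mul_of_nonneg_left ?_ (Real.rpow_nonneg (by linarith [hs.2]) _)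
    exact htmax ⟨htm.1.trans hs.1, hs.2⟩
  have e3 : ∫ s in t..t0, (t0 - s) ^ (β - 1) * v t = (t0 - t) ^ β / β * v t := by
    rw [intervalIntegral.integral_mul_const,
      intervalIntegral.integral_comp_sub_left (fun x => x ^ (β - 1)) t0,
      integral_rpow (Or.inl (by linarith))]
    simp [Real.zero_rpow hβ0.ne']
  have e4 : (t0 / t) ^ (β - 1) * t ^ (β - 1) = t0 ^ (β - 1) := by
    rw [← Real.mul_rpow (by positivity) htpos.le, div_mul_cancel₀ _ htpos.ne']
  have h5 : (1:ℝ) / 2 ≤ (t0 / t) ^ (β - 1) := by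
    have h6 : t0 / t ≤ 2 := by
      rw [div_le_iff₀ htpos]; linarith [htm.1, ht1b.1]
    have h7 : (2:ℝ) ^ (β - 1) ≤ (t0 / t) ^ (β - 1) :=
      Real.rpow_le_rpow_of_nonpos (by positivity) h6 (by linarith)
    have h8 : (2:ℝ) ^ (-1:ℝ) ≤ (2:ℝ) ^ (β - 1) :=
      Real.rpow_le_rpow_of_exponent_le (by norm_num) (by linarith)
    rw [Real.rpow_neg_one] at h8
    linarith
  have h9 : (t0 - t) ^ β / β ≤ (t0 - t1) ^ β / β := by
    have := htm.1
    gcongr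
  have h10 : (t0 - t) ^ β / β * v t < Real.Gamma β / 2 * v t :=
    mul_lt_mul_of_pos_right (by linarith) hvt
  have h11 : 1 / 2 * (Real.Gamma β * v t) ≤ (t0 / t) ^ (β - 1) * (Real.Gamma β * v t) :=
    mul_le_mul_of_nonneg_right h5 (by positivity)
  have h12 : Real.Gamma β * v t0 ≤ 0 := mul_nonpos_of_nonneg_of_nonpos hΓ.le hv0
  rw [mul_sub, e4] at hle1
  linarith

theorem ml_eq (β x : ℝ) : mittagLeffler β x = mlG β 1 x := by
  unfold mittagLeffler mlG
  exact tsum_congr fun k => by rw [add_comm]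

theorem ml_continuous (β : ℝ) (hβ : 0 < β) : Continuous (mittagLeffler β) := by
  have : mittagLeffler β = mlG β 1 := funext (ml_eq β)
  rw [this]
  exact mlG_continuous β 1 hβ one_pos

theorem ml_bounds (β : ℝ) (hβ : β ∈ Set.Ioo (0:ℝ) 1) (y : ℝ) (hy : 0 ≤ y) :
    0 ≤ mittagLeffler β (-y) ∧ mittagLeffler β (-y) ≤ 1 ∧
      y * mittagLeffler β (-y) ≤ Real.Gamma β * β := by
  have hβ0 := hβ.1
  have hβ1 := hβ.2
  have hΓ : 0 < Real.Gamma β := Real.Gamma_pos_of_pos hβ0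
  set u : ℝ → ℝ := fun t => mlG β 1 (-(t ^ β)) with hu
  have huc : Continuous u :=
    (mlG_continuous β 1 hβ0 one_pos).comp (continuous_neg.comp (Real.continuous_rpow_const hβ0.le))
  have hu0 : u 0 = 1 := by
    simp only [hu]
    rw [mlG_shift β 1 _ hβ0 one_pos, Real.zero_rpow hβ0.ne']
    simp
  -- derivative relation in integrated form
  have hV : ∀ t, 0 < t → ∫ s in (0:ℝ)..t, s ^ (β - 1) * mlG β β (-(s ^ β)) = 1 - u t := by
    intro t ht
    have h1 := mlG_integral β 1 β t hβ0 one_pos hβ0 ht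
    have h2 := mlG_shift β 1 (-(t ^ β)) hβ0 one_pos
    simp only [sub_self, Real.rpow_zero, one_mul, Real.Gamma_one] at h1
    simp only [hu]
    rw [h1, h2, add_comm β 1, Real.Gamma_one, show 1 + β - 1 = β by ring]
    ring
  have hVi : ∀ t, 0 < t → IntervalIntegrable (fun s => s ^ (β - 1) * mlG β β (-(s ^ β)))
      volume 0 t := by
    intro t ht
    have h1 := mlG_integrable β 1 β t hβ0 one_pos hβ0 ht
    simpa only [sub_self, Real.rpow_zero, one_mul] using h1
  have hanti' : ∀ s t, 0 < s → s ≤ t → u t ≤ u s := by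
    intro s t hs hst
    have h1 := hV s hs
    have h2 := hV t (hs.trans_le hst)
    have h3 : ∫ x in (0:ℝ)..s, x ^ (β - 1) * mlG β β (-(x ^ β)) ≤
        ∫ x in (0:ℝ)..t, x ^ (β - 1) * mlG β β (-(x ^ β)) := by
      refine intervalIntegral.integral_mono_interval le_rfl hs.le hst ?_ (hVi t (hs.trans_le hst))
      refine (ae_restrict_iff' measurableSet_Ioc).2 (Eventually.of_forall fun x hx => ?_)
      exact mul_nonneg (Real.rpow_nonneg hx.1.le _) (mlG_pos β hβ x hx.1.le).le
    linarith
  have hle1 : ∀ t, 0 ≤ t → u t ≤ 1 := by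
    intro t ht
    rcases ht.eq_or_lt with h | h
    · rw [← h, hu0]
    · have h3 : 0 ≤ ∫ x in (0:ℝ)..t, x ^ (β - 1) * mlG β β (-(x ^ β)) := by
        refine intervalIntegral.integral_nonneg ht fun x hx => ?_
        exact mul_nonneg (Real.rpow_nonneg hx.1 _) (mlG_pos β hβ x hx.1).le
      linarith [hV t h]
  have hI : ∀ t, 0 < t → ∫ s in (0:ℝ)..t, (t - s) ^ (β - 1) * u s = Real.Gamma β * (1 - u t) := by
    intro t ht
    have h1 := mlG_integral β β 1 t hβ0 hβ0 one_pos ht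
    have h2 := mlG_shift β 1 (-(t ^ β)) hβ0 one_pos
    simp only [sub_self, Real.rpow_zero, one_mul] at h1
    simp only [hu]
    rw [h1, h2, Real.Gamma_one, show β + 1 - 1 = β by ring]
    ring
  have hIi : ∀ t, 0 < t → IntervalIntegrable (fun s => (t - s) ^ (β - 1) * u s) volume 0 t := by
    intro t ht
    have h1 := mlG_integrable β β 1 t hβ0 hβ0 one_pos ht
    simpa only [sub_self, Real.rpow_zero, one_mul] using h1
  have hk : ∀ t a b : ℝ, IntervalIntegrable (fun s => (t - s) ^ (β - 1)) volume a b := by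
    intro t a b
    have := (intervalIntegral.intervalIntegrable_rpow' (a := t - a) (b := t - b)
        (r := β - 1) (by linarith)).comp_sub_left t
    simpa using this
  have hkv : ∀ t a b : ℝ, ∫ s in a..b, (t - s) ^ (β - 1) = ((t - a) ^ β - (t - b) ^ β) / β := by
    intro t a b
    rw [intervalIntegral.integral_comp_sub_left (fun x => x ^ (β - 1)) t,
      integral_rpow (Or.inl (by linarith))]
    simp
  have hnn : ∀ t, 0 < t → 0 ≤ u t := by
    intro t1 ht1
    by_contra hc
    push Not at hc
    have hbound : ∀ t, t1 < t → Real.Gamma β * (1 - u t) ≤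
        t1 ^ β / β + u t1 * ((t - t1) ^ β / β) := by
      intro t ht
      have ht0 : 0 < t := ht1.trans ht
      have hs1 : IntervalIntegrable (fun s => (t - s) ^ (β - 1) * u s) volume 0 t1 :=
        (hIi t ht0).mono_set (by
          rw [Set.uIcc_of_le ht1.le, Set.uIcc_of_le ht0.le]
          exact Set.Icc_subset_Icc_right ht.le)
      have hs2 : IntervalIntegrable (fun s => (t - s) ^ (β - 1) * u s) volume t1 t :=
        (hIi t ht0).mono_set (by
          rw [Set.uIcc_of_le ht.le, Set.uIcc_of_le ht0.le]
          exact Set.Icc_subset_Icc_left ht1.le)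
      rw [← hI t ht0, ← intervalIntegral.integral_add_adjacent_intervals hs1 hs2]
      refine add_le_add ?_ ?_
      · have h1 : ∫ s in (0:ℝ)..t1, (t - s) ^ (β - 1) * u s ≤
            ∫ s in (0:ℝ)..t1, (t1 - s) ^ (β - 1) := by
          refine intervalIntegral.integral_mono_on_of_le_Ioo ht1.le hs1 (hk t1 0 t1) ?_
          intro s hs
          have h2 : (t - s) ^ (β - 1) ≤ (t1 - s) ^ (β - 1) :=
            Real.rpow_le_rpow_of_nonpos (by linarith [hs.2]) (by linarith) (by linarith)
          have h3 : 0 ≤ (t - s) ^ (β - 1) := Real.rpow_nonneg (by linarith [hs.2]) _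
          have h4 := hle1 s hs.1.le
          nlinarith
        rw [hkv] at h1
        simpa [Real.zero_rpow hβ0.ne'] using h1
      · have h1 : ∫ s in t1..t, (t - s) ^ (β - 1) * u s ≤
            ∫ s in t1..t, (t - s) ^ (β - 1) * u t1 := by
          refine intervalIntegral.integral_mono_on ht.le hs2 ((hk t t1 t).mul_const _) ?_
          intro s hs
          exact mul_le_mul_of_nonneg_left (hanti' t1 s ht1 hs.1)
            (Real.rpow_nonneg (by linarith [hs.2]) _)
        rw [intervalIntegral.integral_mul_const, hkv] at h1
        simpa [Real.zero_rpow hβ0.ne', mul_comm] using h1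
    have hbound2 : ∀ t, t1 < t → Real.Gamma β ≤ t1 ^ β / β + u t1 * ((t - t1) ^ β / β) := by
      intro t ht
      have h1 := hbound t ht
      have h2 := hanti' t1 t ht1 ht.le
      nlinarith
    have hlim : Tendsto (fun t => (t - t1) ^ β / β) atTop atTop := by
      refine Tendsto.atTop_div_const hβ0 ((tendsto_rpow_atTop hβ0).comp ?_)
      exact tendsto_atTop_add_const_right atTop (-t1) tendsto_id
    obtain ⟨t, h1, h2⟩ := ((hlim.eventually_gt_atTop (t1 ^ β / β / (- u t1))).and
      (eventually_gt_atTop t1)).exists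
    have h3 := hbound2 t h2
    rw [div_lt_iff₀ (by linarith)] at h1
    linarith
  rw [ml_eq]
  rcases hy.eq_or_lt with h | h
  · have e : mlG β 1 (-y) = 1 := by
      have h0 : u 0 = mlG β 1 (-y) := by simp only [hu]; rw [← h, Real.zero_rpow hβ0.ne']
      rw [← h0, hu0]
    rw [e, ← h]
    refine ⟨zero_le_one, le_rfl, ?_⟩
    rw [zero_mul]; positivity
  · set t := y ^ (1 / β) with htdef
    have ht : 0 < t := Real.rpow_pos_of_pos h _
    have hty : t ^ β = y := by
      rw [htdef, ← Real.rpow_mul hy, one_div, inv_mul_cancel₀ hβ0.ne', Real.rpow_one]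
    have e : mlG β 1 (-y) = u t := by simp only [hu]; rw [hty]
    rw [e]
    refine ⟨hnn t ht, hle1 t ht.le, ?_⟩
    have h1 : ∫ s in (0:ℝ)..t, (t - s) ^ (β - 1) * u t ≤
        ∫ s in (0:ℝ)..t, (t - s) ^ (β - 1) * u s := by
      refine intervalIntegral.integral_mono_on_of_le_Ioo ht.le ((hk t 0 t).mul_const _)
        (hIi t ht) ?_
      intro s hs
      exact mul_le_mul_of_nonneg_left (hanti' s t hs.1 hs.2.le)
        (Real.rpow_nonneg (by linarith [hs.2]) _)
    rw [intervalIntegral.integral_mul_const, hkv, hI t ht] at h1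
    simp only [sub_zero, sub_self, Real.zero_rpow hβ0.ne'] at h1
    rw [hty] at h1
    have h2 : Real.Gamma β * (1 - u t) ≤ Real.Gamma β := by nlinarith [hnn t ht]
    have h3 : y / β * u t ≤ Real.Gamma β := h1.trans h2
    rw [div_mul_eq_mul_div, div_le_iff₀ hβ0] at h3
    exact h3

/-! ### The Bessel factor -/

/-- Auxiliary integral representing `z^a K_{-a}(z)`. -/
noncomputable def besW (a z : ℝ) : ℝ :=
  ∫ σ in Set.Ioi (0:ℝ), σ ^ (a - 1) * Real.exp (-(σ / 2) - z ^ 2 / (2 * σ))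

theorem bessel_rep (a z : ℝ) (hz : 0 < z) :
    z ^ a * besselK (-a) z = 1 / 2 * besW a z := by
  unfold besselK besW
  set g : ℝ → ℝ := fun s => s ^ (-a - 1) * Real.exp (-(z / 2) * (s + 1 / s)) with hg
  have h1 := integral_comp_mul_left_Ioi g 0 hz
  rw [mul_zero, smul_eq_mul] at h1
  have h2 := integral_comp_rpow_Ioi (fun x => g (z * x)) (p := -1) (by norm_num)
  have h3 : (∫ σ in Set.Ioi (0:ℝ), σ ^ (a - 1) * Real.exp (-(σ / 2) - z ^ 2 / (2 * σ))) =
      z ^ (a + 1) * ∫ x in Set.Ioi (0:ℝ), g (z * x) := by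
    rw [← h2, ← integral_const_mul]
    refine setIntegral_congr_fun measurableSet_Ioi fun σ hσ => ?_
    have hσ' : 0 < σ := hσ
    simp only [hg, smul_eq_mul]
    rw [Real.rpow_neg_one, show (-1 - 1 : ℝ) = -2 by norm_num, abs_neg, abs_one, one_mul]
    have e1 : -(z / 2) * (z * σ⁻¹ + 1 / (z * σ⁻¹)) = -(σ / 2) - z ^ 2 / (2 * σ) := by
      field_simp
      ring
    have e2 : (z * σ⁻¹) ^ (-a - 1) = z ^ (-(a + 1)) * σ ^ (a + 1) := by
      rw [Real.mul_rpow hz.le (by positivity), ← Real.rpow_neg_one σ, ← Real.rpow_mul hσ'.le]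
      congr 2 <;> ring
    rw [e1, e2, Real.rpow_neg hz.le]
    have e3 : σ ^ (a - 1) = σ ^ (-2 : ℝ) * σ ^ (a + 1) := by
      rw [← Real.rpow_add hσ']; congr 1; ring
    rw [e3]
    have := (Real.rpow_pos_of_pos hz (a + 1)).ne'
    field_simp
  rw [h3, h1, Real.rpow_add hz, Real.rpow_one]
  field_simp

theorem besW_integrable0 (a : ℝ) (ha : 0 < a) :
    IntegrableOn (fun σ : ℝ => σ ^ (a - 1) * Real.exp (-(σ / 2))) (Set.Ioi 0) := by
  have h := integrableOn_rpow_mul_exp_neg_mul_rpow (p := 1) (s := a - 1) (b := 1 / 2) (by linarith)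
    one_pos (by norm_num)
  refine h.congr_fun (fun σ _ => ?_) measurableSet_Ioi
  simp only [Real.rpow_one]
  congr 2; ring

theorem besW_zero (a : ℝ) (ha : 0 < a) : besW a 0 = 2 ^ a * Real.Gamma a := by
  have h := Real.integral_rpow_mul_exp_neg_mul_Ioi (a := a) (r := 1 / 2) ha (by norm_num)
  unfold besW
  rw [show (1 / (1 / 2) : ℝ) = 2 by norm_num] at h
  rw [← h]
  refine setIntegral_congr_fun measurableSet_Ioi fun σ _ => ?_
  congr 2
  ring

theorem besW_meas (a z : ℝ) :
    Measurable (fun σ : ℝ => σ ^ (a - 1) * Real.exp (-(σ / 2) - z ^ 2 / (2 * σ))) := by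
  fun_prop

theorem besW_le (a z σ : ℝ) (hσ : 0 < σ) :
    σ ^ (a - 1) * Real.exp (-(σ / 2) - z ^ 2 / (2 * σ)) ≤ σ ^ (a - 1) * Real.exp (-(σ / 2)) := by
  gcongr
  have : 0 ≤ z ^ 2 / (2 * σ) := by positivity
  linarith

theorem besW_integrable (a z : ℝ) (ha : 0 < a) :
    IntegrableOn (fun σ : ℝ => σ ^ (a - 1) * Real.exp (-(σ / 2) - z ^ 2 / (2 * σ))) (Set.Ioi 0) := by
  refine Integrable.mono' (besW_integrable0 a ha) (besW_meas a z).aestronglyMeasurable ?_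
  refine (ae_restrict_iff' measurableSet_Ioi).2 (Eventually.of_forall fun σ hσ => ?_)
  have hσ' : 0 < σ := hσ
  rw [Real.norm_of_nonneg (by positivity)]
  exact besW_le a z σ hσ

theorem besW_nonneg (a z : ℝ) : 0 ≤ besW a z := by
  refine setIntegral_nonneg measurableSet_Ioi fun σ hσ => ?_
  have hσ' : 0 < σ := hσ
  positivity

theorem besW_le_zero (a z : ℝ) (ha : 0 < a) : besW a z ≤ besW a 0 := by
  refine setIntegral_mono_on (besW_integrable a z ha) (besW_integrable a 0 ha) measurableSet_Ioi
    fun σ hσ => ?_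
  have := besW_le a z σ hσ
  simpa using this

theorem besW_tendsto (a : ℝ) (ha : 0 < a) : Tendsto (besW a) (𝓝[>] 0) (𝓝 (besW a 0)) := by
  refine tendsto_integral_filter_of_dominated_convergence
    (fun σ : ℝ => σ ^ (a - 1) * Real.exp (-(σ / 2)))
    (Eventually.of_forall fun z => (besW_meas a z).aestronglyMeasurable)
    (Eventually.of_forall fun z => ?_) (besW_integrable0 a ha) ?_
  · refine (ae_restrict_iff' measurableSet_Ioi).2 (Eventually.of_forall fun σ hσ => ?_)
    have hσ' : 0 < σ := hσ
    rw [Real.norm_of_nonneg (by positivity)]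
    exact besW_le a z σ hσ
  · refine Eventually.of_forall fun σ => ?_
    have hc : Continuous fun z : ℝ => σ ^ (a - 1) * Real.exp (-(σ / 2) - z ^ 2 / (2 * σ)) := by
      fun_prop
    exact (hc.tendsto 0).mono_left nhdsWithin_le_nhds

theorem besW_decay (a : ℝ) (ha : 0 < a) : ∃ C, 0 ≤ C ∧ ∀ z, z ^ 2 * besW a z ≤ C := by
  refine ⟨2 * ∫ σ in Set.Ioi (0:ℝ), σ ^ (a + 1 - 1) * Real.exp (-(σ / 2)), ?_, fun z => ?_⟩
  · refine mul_nonneg zero_le_two (setIntegral_nonneg measurableSet_Ioi fun σ hσ => ?_)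
    have hσ' : 0 < σ := hσ
    positivity
  · unfold besW
    rw [← integral_const_mul, ← integral_const_mul]
    refine setIntegral_mono_on ((besW_integrable a z ha).const_mul _)
      ((besW_integrable0 (a + 1) (by linarith)).const_mul _) measurableSet_Ioi fun σ hσ => ?_
    have hσ' : 0 < σ := hσ
    have e1 : σ ^ (a + 1 - 1) = σ ^ (a - 1) * σ := by
      rw [show a + 1 - 1 = (a - 1) + 1 by ring, Real.rpow_add hσ', Real.rpow_one]
    rw [e1, sub_eq_add_neg (-(σ / 2)), Real.exp_add]
    have e2 : z ^ 2 * Real.exp (-(z ^ 2 / (2 * σ))) ≤ 2 * σ := by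
      set y := z ^ 2 / (2 * σ) with hy
      have hz : z ^ 2 = y * (2 * σ) := by rw [hy]; field_simp
      have h1 : y * Real.exp (-y) ≤ 1 := by
        have h2 := Real.add_one_le_exp y
        rw [Real.exp_neg, ← div_eq_mul_inv, div_le_one (Real.exp_pos y)]
        linarith
      rw [hz]
      nlinarith
    have h3 : 0 ≤ σ ^ (a - 1) * Real.exp (-(σ / 2)) := by positivity
    have := mul_le_mul_of_nonneg_left e2 h3
    linarith

theorem theta_rep (κ : ℝ) (hκ : κ ∈ Set.Ioo (0:ℝ) 1) (z : ℝ) (hz : 0 < z) :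
    1 - theta κ z = besW ((1 - κ) / 2) z / besW ((1 - κ) / 2) 0 := by
  obtain ⟨h0, h1⟩ := hκ
  set a := (1 - κ) / 2 with ha
  have ha0 : 0 < a := by rw [ha]; linarith
  unfold theta
  have e0 : (κ - 1) / 2 = -a := by rw [ha]; ring
  rw [e0, ← ha, sub_sub_cancel, mul_assoc, bessel_rep a z hz, besW_zero a ha0]
  have hG1 : 0 < Real.Gamma κ := Real.Gamma_pos_of_pos h0
  have hG2 : 0 < Real.Gamma (κ / 2) := Real.Gamma_pos_of_pos (by linarith)
  have hG3 : 0 < Real.Gamma a := Real.Gamma_pos_of_pos ha0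
  have hpi := Real.pi_pos
  have hcos : 0 < Real.cos (π * κ / 2) := Real.cos_pos_of_mem_Ioo ⟨by nlinarith, by nlinarith⟩
  have hdup := Real.Gamma_mul_Gamma_add_half (κ / 2)
  have hrefl := Real.Gamma_mul_Gamma_one_sub a
  have e1 : 1 - a = κ / 2 + 1 / 2 := by rw [ha]; ring
  have e2 : Real.sin (π * a) = Real.cos (π * κ / 2) := by
    rw [← Real.cos_pi_div_two_sub]; congr 1; rw [ha]; ring
  rw [e1, e2] at hrefl
  have e3 : 2 * (κ / 2) = κ := by ring
  rw [e3] at hdup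
  have hcs := hcos.ne'
  rw [eq_div_iff hcs] at hrefl
  have hsp : 0 < √π := Real.sqrt_pos.2 hpi
  have hsq : √π * √π = π := Real.mul_self_sqrt hpi.le
  have e4 : (2:ℝ) ^ ((3 - κ) / 2) = 2 ^ (1 - κ) * 2 * 2 ^ (-a) := by
    rw [mul_assoc, ← Real.rpow_one_add' (by norm_num) (by rw [ha]; linarith), ← Real.rpow_add (by norm_num)]
    congr 1; rw [ha]; ring
  -- main identity
  have key : (2:ℝ) ^ (1 - κ) * Real.Gamma κ * Real.cos (π * κ / 2) * Real.Gamma a =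
      √π * Real.Gamma (κ / 2) := by
    have h5 : Real.Gamma (κ / 2) * ((2:ℝ) ^ (1 - κ) * Real.Gamma κ * Real.cos (π * κ / 2) * Real.Gamma a) * √π
        = Real.Gamma (κ / 2) * (√π * Real.Gamma (κ / 2)) * √π := by
      calc _ = Real.Gamma (κ / 2) * (Real.Gamma κ * (2:ℝ) ^ (1 - κ) * √π) *
            Real.cos (π * κ / 2) * Real.Gamma a := by ring
        _ = Real.Gamma (κ / 2) * (Real.Gamma (κ / 2) * Real.Gamma (κ / 2 + 1 / 2)) *
            Real.cos (π * κ / 2) * Real.Gamma a := by rw [hdup]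
        _ = Real.Gamma (κ / 2) * Real.Gamma (κ / 2) * (Real.Gamma a * Real.Gamma (κ / 2 + 1 / 2) *
            Real.cos (π * κ / 2)) := by ring
        _ = Real.Gamma (κ / 2) * Real.Gamma (κ / 2) * (√π * √π) := by rw [hrefl, hsq]
        _ = _ := by ring
    have h6 := mul_right_cancel₀ hsp.ne' h5
    exact mul_left_cancel₀ hG2.ne' h6
  rw [e4, ← key, Real.rpow_neg (by norm_num)]
  have h2a : (0:ℝ) < 2 ^ a := by positivity
  have h2k : (0:ℝ) < 2 ^ (1 - κ) := by positivity
  generalize Real.cos (π * κ / 2) = c at *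
  field_simp

theorem theta_bounds (κ : ℝ) (hκ : κ ∈ Set.Ioo (0:ℝ) 1) (z : ℝ) (hz : 0 < z) :
    0 ≤ 1 - theta κ z ∧ 1 - theta κ z ≤ 1 := by
  have ha0 : 0 < (1 - κ) / 2 := by linarith [hκ.2]
  have hW : 0 < besW ((1 - κ) / 2) 0 := by
    rw [besW_zero _ ha0]
    have := Real.Gamma_pos_of_pos ha0
    positivity
  rw [theta_rep κ hκ z hz]
  refine ⟨div_nonneg (besW_nonneg _ _) hW.le, ?_⟩
  rw [div_le_one hW]
  exact besW_le_zero _ _ ha0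

theorem theta_decay (κ : ℝ) (hκ : κ ∈ Set.Ioo (0:ℝ) 1) :
    ∃ C, 0 ≤ C ∧ ∀ z, 0 < z → z ^ 2 * (1 - theta κ z) ≤ C := by
  have ha0 : 0 < (1 - κ) / 2 := by linarith [hκ.2]
  have hW : 0 < besW ((1 - κ) / 2) 0 := by
    rw [besW_zero _ ha0]
    have := Real.Gamma_pos_of_pos ha0
    positivity
  obtain ⟨C, hC0, hC⟩ := besW_decay _ ha0
  refine ⟨C / besW ((1 - κ) / 2) 0, by positivity, fun z hz => ?_⟩
  rw [theta_rep κ hκ z hz, ← mul_div_assoc]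
  exact div_le_div_of_nonneg_right (hC z) hW.le

theorem theta_tendsto (κ : ℝ) (hκ : κ ∈ Set.Ioo (0:ℝ) 1) :
    Tendsto (fun z => 1 - theta κ z) (𝓝[>] 0) (𝓝 1) := by
  have ha0 : 0 < (1 - κ) / 2 := by linarith [hκ.2]
  have hW : 0 < besW ((1 - κ) / 2) 0 := by
    rw [besW_zero _ ha0]
    have := Real.Gamma_pos_of_pos ha0
    positivity
  have h := (besW_tendsto _ ha0).div_const (besW ((1 - κ) / 2) 0)
  rw [div_self hW.ne'] at h
  refine h.congr' ?_
  filter_upwards [self_mem_nhdsWithin] with z hz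
  exact (theta_rep κ hκ z hz).symm

theorem besselK_measurable (ν : ℝ) : Measurable (besselK ν) := by
  have h : StronglyMeasurable (Function.uncurry fun z s : ℝ =>
      s ^ (ν - 1) * Real.exp (-(z / 2) * (s + 1 / s))) := by
    apply Measurable.stronglyMeasurable
    unfold Function.uncurry
    fun_prop
  have h2 := h.integral_prod_right (ν := volume.restrict (Set.Ioi (0:ℝ)))
  exact h2.measurable.const_mul _

theorem theta_measurable (κ : ℝ) : Measurable (theta κ) := by
  unfold theta
  have := besselK_measurable ((κ - 1) / 2)
  fun_prop

/-! ### Power bounds and integrability -/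

/-- Piecewise power function used as an integrable majorant. -/
noncomputable def powB (a b r : ℝ) : ℝ := if r ≤ 1 then r ^ a else r ^ b

theorem powB_nonneg (a b r : ℝ) (hr : 0 ≤ r) : 0 ≤ powB a b r := by
  unfold powB
  split_ifs <;> positivity

theorem powB_measurable (a b : ℝ) : Measurable (powB a b) := by
  unfold powB
  exact Measurable.ite measurableSet_Iic (by fun_prop) (by fun_prop)

theorem powB_integrable (a b : ℝ) (ha : -1 < a) (hb : b < -1) :
    Integrable (fun x : ℝ => powB a b |x|) := by
  have hpos : IntegrableOn (fun x : ℝ => powB a b |x|) (Set.Ioi 0) := by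
    have h1 : IntegrableOn (fun x : ℝ => powB a b |x|) (Set.Ioc 0 1) := by
      have h := (intervalIntegral.intervalIntegrable_rpow' (a := 0) (b := 1) ha).1
      refine h.congr_fun (fun x hx => ?_) measurableSet_Ioc
      simp only [powB]
      rw [abs_of_pos hx.1, if_pos hx.2]
    have h2 : IntegrableOn (fun x : ℝ => powB a b |x|) (Set.Ioi 1) := by
      refine (integrableOn_Ioi_rpow_of_lt hb one_pos).congr_fun (fun x hx => ?_) measurableSet_Ioi
      have hx' : 1 < x := hx
      simp only [powB]
      rw [abs_of_pos (by linarith), if_neg (by linarith)]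
    rw [← Set.Ioc_union_Ioi_eq_Ioi zero_le_one]
    exact h1.union h2
  have hneg : IntegrableOn (fun x : ℝ => powB a b |x|) (Set.Iic 0) := by
    have h : IntegrableOn (fun x : ℝ => powB a b |x|) (Set.Ici 0) :=
      hpos.congr_set_ae Ioi_ae_eq_Ici.symm
    have h2 : IntegrableOn (fun x : ℝ => powB a b |-x|) (Set.Iic 0) := by
      have h3 := h.comp_neg
      simpa using h3
    simpa only [abs_neg] using h2
  rw [← integrableOn_univ, ← Set.Iic_union_Ioi (a := (0:ℝ))]
  exact hneg.union hpos

theorem powB_le (a b r ρ : ℝ) (ha : a ≤ 0) (hb : b ≤ 0) (hρ : 0 < ρ) (hr : ρ ≤ r) :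
    powB a b r ≤ ρ ^ a + 1 := by
  unfold powB
  have h0 : 0 ≤ ρ ^ a := by positivity
  split_ifs with h
  · have := Real.rpow_le_rpow_of_nonpos hρ hr ha
    linarith
  · have := Real.rpow_le_one_of_one_le_of_nonpos (by linarith : 1 ≤ r) hb
    linarith

/-- Growth bound for slowly varying functions. -/
theorem sv_growth (L : ℝ → ℝ) (hm : Measurable L) (hpos : ∀ x : ℝ, 0 < x → 0 < L x)
    (hslow : ∀ u : ℝ, 0 < u → Tendsto (fun x : ℝ => L (u * x) / L x) atTop (𝓝 1))
    (hb : ∀ b : ℝ, 0 < b → ∃ C : ℝ, ∀ x ∈ Set.Ioc (0 : ℝ) b, L x ≤ C)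
    (η : ℝ) (hη : 0 < η) : ∃ C, 0 ≤ C ∧ ∀ y, 0 < y → L y ≤ C * (1 + y ^ η) := by
  obtain ⟨X, hX1, hX⟩ := sv_potter L hm hpos hslow η hη
  have hX0 : 0 < X := by linarith
  obtain ⟨C, hC⟩ := hb X hX0
  have hLX := hpos X hX0
  have hC0 : 0 ≤ C := hLX.le.trans (hC X ⟨hX0, le_rfl⟩)
  refine ⟨C + Real.exp 1 * L X, by positivity, fun y hy => ?_⟩
  have hyη : 0 ≤ y ^ η := by positivity
  have he : 0 < Real.exp 1 * L X := by positivity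
  rcases le_total y X with h | h
  · have := hC y ⟨hy, h⟩
    nlinarith
  · have h1 := hX X y le_rfl h
    have h2 : (y / X) ^ η ≤ y ^ η := by
      apply Real.rpow_le_rpow (by positivity) _ hη.le
      exact div_le_self hy.le hX1
    have h3 : (X / y) ^ η ≤ 1 := by
      apply Real.rpow_le_one (by positivity) _ hη.le
      rw [div_le_one hy]; exact h
    have h4 : Real.exp 1 * L X * ((y / X) ^ η + (X / y) ^ η) ≤ Real.exp 1 * L X * (1 + y ^ η) :=
      mul_le_mul_of_nonneg_left (by linarith) he.le
    nlinarith

/-- One term of the spectral density, without constants. -/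
noncomputable def specG (κ : ℝ) (L : ℝ → ℝ) (r : ℝ) : ℝ := (1 - theta κ r) * L (1 / r) / r ^ (1 - κ)

theorem specG_measurable (κ : ℝ) (L : ℝ → ℝ) (hm : Measurable L) : Measurable (specG κ L) := by
  unfold specG
  have := theta_measurable κ
  fun_prop

theorem specG_nonneg (κ : ℝ) (hκ : κ ∈ Set.Ioo (0:ℝ) 1) (L : ℝ → ℝ)
    (hpos : ∀ x : ℝ, 0 < x → 0 < L x) (r : ℝ) (hr : 0 < r) : 0 ≤ specG κ L r := by
  unfold specG
  have h1 := (theta_bounds κ hκ r hr).1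
  have h2 := (hpos (1 / r) (by positivity)).le
  positivity

theorem specG_bound (κ : ℝ) (hκ : κ ∈ Set.Ioo (0:ℝ) 1) (L : ℝ → ℝ) (hm : Measurable L)
    (hpos : ∀ x : ℝ, 0 < x → 0 < L x)
    (hslow : ∀ u : ℝ, 0 < u → Tendsto (fun x : ℝ => L (u * x) / L x) atTop (𝓝 1))
    (hb : ∀ b : ℝ, 0 < b → ∃ C : ℝ, ∀ x ∈ Set.Ioc (0 : ℝ) b, L x ≤ C) :
    ∃ C, 0 ≤ C ∧ ∀ r, 0 < r → specG κ L r ≤ C * powB (κ / 2 - 1) (-2) r := by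
  obtain ⟨C, hC0, hC⟩ := sv_growth L hm hpos hslow hb (κ / 2) (by linarith [hκ.1])
  obtain ⟨D, hD0, hD⟩ := theta_decay κ hκ
  refine ⟨2 * C + 2 * C * D, by positivity, fun r hr => ?_⟩
  obtain ⟨ht0, ht1⟩ := theta_bounds κ hκ r hr
  have hL := hC (1 / r) (by positivity)
  have hLp := hpos (1 / r) (by positivity)
  have hκ0 := hκ.1
  have hκ1 := hκ.2
  unfold specG powB
  rw [div_le_iff₀ (by positivity)]
  have hri : (1 / r) ^ (κ / 2) = r ^ (-(κ / 2)) := by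
    rw [one_div, Real.inv_rpow hr.le, Real.rpow_neg hr.le]
  rw [hri] at hL
  split_ifs with h
  · have h1 : 1 ≤ r ^ (-(κ / 2)) := Real.one_le_rpow_of_pos_of_le_one_of_nonpos hr h (by linarith)
    have e : r ^ (κ / 2 - 1) * r ^ (1 - κ) = r ^ (-(κ / 2)) := by
      rw [← Real.rpow_add hr]; congr 1; ring
    rw [mul_assoc, e]
    have h2 : L (1 / r) ≤ 2 * C * r ^ (-(κ / 2)) := by nlinarith
    have h3 : (1 - theta κ r) * L (1 / r) ≤ L (1 / r) := mul_le_of_le_one_left hLp.le ht1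
    have h4 : 0 ≤ 2 * C * D * r ^ (-(κ / 2)) := by positivity
    linarith
  · push Not at h
    have h1 : r ^ (-(κ / 2)) ≤ 1 := Real.rpow_le_one_of_one_le_of_nonpos h.le (by linarith)
    have h2 : L (1 / r) ≤ 2 * C := by nlinarith
    have h3 : 1 ≤ r ^ (1 - κ) := Real.one_le_rpow h.le (by linarith)
    have e : r ^ (-2:ℝ) = (r ^ 2)⁻¹ := by
      rw [Real.rpow_neg hr.le]; norm_cast
    have h4 : 1 - theta κ r ≤ D * r ^ (-2:ℝ) := by
      rw [e, ← div_eq_mul_inv, le_div_iff₀ (by positivity), mul_comm]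
      exact hD r hr
    have h5 : (1 - theta κ r) * L (1 / r) ≤ D * r ^ (-2:ℝ) * (2 * C) :=
      mul_le_mul h4 h2 hLp.le (by positivity)
    have h6 : 0 ≤ (2 * C + 2 * C * D) * r ^ (-2:ℝ) := by positivity
    have h7 : 0 ≤ C * r ^ (-2:ℝ) := by positivity
    have h8 := mul_le_mul_of_nonneg_left h3 h6
    nlinarith

theorem rem_integrable (κ : ℝ) (hκ : κ ∈ Set.Ioo (0:ℝ) 1) (L : ℝ → ℝ) (hm : Measurable L)
    (hpos : ∀ x : ℝ, 0 < x → 0 < L x)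
    (hslow : ∀ u : ℝ, 0 < u → Tendsto (fun x : ℝ => L (u * x) / L x) atTop (𝓝 1))
    (hb : ∀ b : ℝ, 0 < b → ∃ C : ℝ, ∀ x ∈ Set.Ioc (0 : ℝ) b, L x ≤ C)
    (w : ℝ) (hw : w ≠ 0) (p : ℝ) (hp : p ∈ Set.Ioo (0:ℝ) 1) :
    Integrable (fun x : ℝ => |x| ^ (-p) * specG κ L |x + w|) := by
  obtain ⟨C, hC0, hC⟩ := specG_bound κ hκ L hm hpos hslow hb
  obtain ⟨hp0, hp1⟩ := hp
  have hκ0 := hκ.1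
  have hκ1 := hκ.2
  set ρ := |w| / 2 with hρdef
  have hρ : 0 < ρ := by have := abs_pos.2 hw; positivity
  set M := C * (ρ ^ (κ / 2 - 1) + 1) with hM
  have hM0 : 0 ≤ M := by positivity
  have hdom : Integrable (fun x : ℝ => M * (1 + ρ ^ 2) * powB (-p) (-2) |x| +
      ρ ^ (-p) * C * powB (κ / 2 - 1) (-2) |x + w|) := by
    refine ((powB_integrable (-p) (-2) (by linarith) (by norm_num)).const_mul _).add ?_
    have := (powB_integrable (κ / 2 - 1) (-2) (by linarith) (by norm_num)).comp_add_right w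
    exact this.const_mul _
  refine hdom.mono' ?_ ?_
  · have := specG_measurable κ L hm
    have h2 : Measurable (fun x : ℝ => |x| ^ (-p) * specG κ L |x + w|) := by fun_prop
    exact h2.aestronglyMeasurable
  · have hne : ∀ᵐ x : ℝ, x ≠ -w ∧ x ≠ 0 := by
      have h1 : ∀ᵐ x : ℝ, x ≠ -w := by simp [ae_iff, measure_singleton]
      have h2 : ∀ᵐ x : ℝ, x ≠ 0 := by simp [ae_iff, measure_singleton]
      exact h1.and h2
    filter_upwards [hne] with x hx
    have hxw : 0 < |x + w| := abs_pos.2 fun h => hx.1 (by linarith)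
    have hx0 : 0 < |x| := abs_pos.2 hx.2
    have hG := specG_nonneg κ hκ L hpos _ hxw
    rw [Real.norm_of_nonneg (by positivity)]
    have hB := hC _ hxw
    have hB1 := powB_nonneg (-p) (-2) |x| (abs_nonneg x)
    have hB2 := powB_nonneg (κ / 2 - 1) (-2) |x + w| (abs_nonneg _)
    rcases le_total |x| ρ with h | h
    · have h1 : ρ ≤ |x + w| := by
        have h2 : |w| ≤ |x + w| + |x| := by
          have := abs_sub (x + w) x
          simpa using this
        have h3 : |w| = 2 * ρ := by rw [hρdef]; ring
        linarith
      have h2 := powB_le (κ / 2 - 1) (-2) _ ρ (by linarith) (by norm_num) hρ h1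
      have h3 : specG κ L |x + w| ≤ M := hB.trans (mul_le_mul_of_nonneg_left h2 hC0)
      have h4 : |x| ^ (-p) ≤ (1 + ρ ^ 2) * powB (-p) (-2) |x| := by
        unfold powB
        split_ifs with h5
        · have : 0 ≤ |x| ^ (-p) := by positivity
          nlinarith [sq_nonneg ρ]
        · push Not at h5
          have h6 : |x| ^ (-p) ≤ 1 := Real.rpow_le_one_of_one_le_of_nonpos h5.le (by linarith)
          have e : |x| ^ (-2:ℝ) = (|x| ^ 2)⁻¹ := by
            rw [Real.rpow_neg hx0.le]; norm_cast
          have h7 : 1 ≤ (1 + ρ ^ 2) * |x| ^ (-2:ℝ) := by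
            rw [e, ← div_eq_mul_inv, le_div_iff₀ (by positivity), one_mul]
            nlinarith
          linarith
      have h5 : |x| ^ (-p) * specG κ L |x + w| ≤ (1 + ρ ^ 2) * powB (-p) (-2) |x| * M :=
        mul_le_mul h4 h3 hG (by positivity)
      have h6 : 0 ≤ ρ ^ (-p) * C * powB (κ / 2 - 1) (-2) |x + w| := by positivity
      linarith
    · have h1 : |x| ^ (-p) ≤ ρ ^ (-p) := Real.rpow_le_rpow_of_nonpos hρ h (by linarith)
      have h2 : |x| ^ (-p) * specG κ L |x + w| ≤ ρ ^ (-p) * (C * powB (κ / 2 - 1) (-2) |x + w|) :=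
        mul_le_mul h1 hB hG (by positivity)
      have h3 : 0 ≤ M * (1 + ρ ^ 2) * powB (-p) (-2) |x| := by positivity
      linarith

/-! ### The leading term -/

theorem sv_ratio_bound (L : ℝ → ℝ) (hm : Measurable L) (hpos : ∀ x : ℝ, 0 < x → 0 < L x)
    (hslow : ∀ u : ℝ, 0 < u → Tendsto (fun x : ℝ => L (u * x) / L x) atTop (𝓝 1))
    (hb : ∀ b : ℝ, 0 < b → ∃ C : ℝ, ∀ x ∈ Set.Ioc (0 : ℝ) b, L x ≤ C)
    (η : ℝ) (hη : 0 < η) : ∃ δ₀ C, 0 < δ₀ ∧ 0 ≤ C ∧ ∀ δ r, 0 < δ → δ < δ₀ → 0 < r →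
      L (1 / (δ * r)) / L (1 / δ) ≤ C * (r ^ η + r ^ (-η)) := by
  obtain ⟨X, hX1, hX⟩ := sv_potter L hm hpos hslow η hη
  have hX0 : 0 < X := by linarith
  obtain ⟨D, hD⟩ := hb X hX0
  have hLX := hpos X hX0
  have hD0 : 0 ≤ D := hLX.le.trans (hD X ⟨hX0, le_rfl⟩)
  refine ⟨1 / X, Real.exp 1 + D / L X * (2 * Real.exp 1), by positivity, by positivity,
    fun δ r hδ hδ0 hr => ?_⟩
  have hXδ : X ≤ 1 / δ := by
    rw [le_div_iff₀ hδ]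
    have := (lt_div_iff₀ hX0).1 hδ0
    nlinarith
  have hLδ := hpos (1 / δ) (by positivity)
  rw [div_le_iff₀ hLδ]
  have hr1 : 0 < r ^ η := by positivity
  have hr2 : 0 < r ^ (-η) := by positivity
  have he : 0 < Real.exp 1 := Real.exp_pos 1
  rcases le_total X (1 / (δ * r)) with h | h
  · have h1 := hX (1 / δ) (1 / (δ * r)) hXδ h
    have e1 : (1 / (δ * r)) / (1 / δ) = r⁻¹ := by field_simp
    have e2 : (1 / δ) / (1 / (δ * r)) = r := by field_simp
    rw [e1, e2, Real.inv_rpow hr.le, ← Real.rpow_neg hr.le] at h1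
    have : 0 ≤ D / L X * (2 * Real.exp 1) * (r ^ η + r ^ (-η)) * L (1 / δ) := by positivity
    nlinarith
  · have h1 := hD (1 / (δ * r)) ⟨by positivity, h⟩
    have h2 := hX (1 / δ) X hXδ le_rfl
    have h3 : (X / (1 / δ)) ^ η ≤ r ^ η := by
      apply Real.rpow_le_rpow (by positivity) _ hη.le
      rw [div_div_eq_mul_div, div_one]
      have a1 := (div_le_iff₀ (by positivity)).1 h
      have a2 : X * δ ≤ 1 := (le_div_iff₀ hδ).1 hXδ
      have a3 : 0 < X * δ := by positivity
      nlinarith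
    have h4 : ((1 / δ) / X) ^ η ≤ r ^ η := by
      apply Real.rpow_le_rpow (by positivity) _ hη.le
      rw [div_le_iff₀ hX0, div_le_iff₀ hδ]
      have := (div_le_iff₀ (by positivity)).1 h
      nlinarith
    have h5 : L X ≤ Real.exp 1 * L (1 / δ) * (2 * r ^ η) :=
      h2.trans (mul_le_mul_of_nonneg_left (by linarith) (by positivity))
    have h6 : D ≤ D / L X * (Real.exp 1 * L (1 / δ) * (2 * r ^ η)) := by
      calc D = D / L X * L X := by field_simp
        _ ≤ _ := mul_le_mul_of_nonneg_left h5 (by positivity)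
    have h7 : 0 ≤ Real.exp 1 * (r ^ η + r ^ (-η)) * L (1 / δ) := by positivity
    have h8 : 0 ≤ D / L X * (Real.exp 1 * L (1 / δ) * (2 * r ^ (-η))) := by positivity
    nlinarith

theorem sv_inv_bound (L : ℝ → ℝ) (hm : Measurable L) (hpos : ∀ x : ℝ, 0 < x → 0 < L x)
    (hslow : ∀ u : ℝ, 0 < u → Tendsto (fun x : ℝ => L (u * x) / L x) atTop (𝓝 1))
    (q : ℝ) (hq : 0 < q) : Tendsto (fun δ : ℝ => δ ^ q / L (1 / δ)) (𝓝[>] 0) (𝓝 0) := by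
  obtain ⟨X, hX1, hX⟩ := sv_potter L hm hpos hslow (q / 2) (by linarith)
  have hX0 : 0 < X := by linarith
  have hLX := hpos X hX0
  have hlim : Tendsto (fun δ : ℝ => 2 * Real.exp 1 / L X * δ ^ (q / 2)) (𝓝[>] 0) (𝓝 0) := by
    have h1 : ContinuousAt (fun δ : ℝ => 2 * Real.exp 1 / L X * δ ^ (q / 2)) 0 := by
      have := Real.continuousAt_rpow_const 0 (q / 2) (Or.inr (by linarith))
      exact continuousAt_const.mul this
    have h2 := h1.tendsto
    rw [Real.zero_rpow (by linarith), mul_zero] at h2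
    exact h2.mono_left nhdsWithin_le_nhds
  refine squeeze_zero' ?_ ?_ hlim
  · filter_upwards [self_mem_nhdsWithin] with δ hδ
    have hδ : 0 < δ := hδ
    have := hpos (1 / δ) (by positivity)
    positivity
  · have hmem : Set.Ioo (0:ℝ) (1 / X) ∈ 𝓝[>] (0:ℝ) := Ioo_mem_nhdsGT (by positivity)
    filter_upwards [hmem] with δ hδ
    obtain ⟨hδ, hδ0⟩ := hδ
    have hδX : δ * X < 1 := (lt_div_iff₀ hX0).1 hδ0
    have hXδ : X ≤ 1 / δ := by
      rw [le_div_iff₀ hδ]; nlinarith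
    have hδ1 : δ ≤ 1 := by nlinarith
    have hLδ := hpos (1 / δ) (by positivity)
    have h2 := hX (1 / δ) X hXδ le_rfl
    have h3 : (X / (1 / δ)) ^ (q / 2) ≤ δ ^ (-(q / 2)) := by
      have a1 : (X / (1 / δ)) ^ (q / 2) ≤ 1 := by
        apply Real.rpow_le_one (by positivity) _ (by linarith)
        rw [div_div_eq_mul_div, div_one]; nlinarith
      exact a1.trans (Real.one_le_rpow_of_pos_of_le_one_of_nonpos hδ hδ1 (by linarith))
    have h4 : ((1 / δ) / X) ^ (q / 2) ≤ δ ^ (-(q / 2)) := by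
      rw [Real.rpow_neg hδ.le, ← Real.inv_rpow hδ.le, ← one_div]
      apply Real.rpow_le_rpow (by positivity) _ (by linarith)
      exact div_le_self (by positivity) hX1
    have h5 : L X ≤ Real.exp 1 * L (1 / δ) * (2 * δ ^ (-(q / 2))) :=
      h2.trans (mul_le_mul_of_nonneg_left (by linarith) (by positivity))
    rw [div_le_iff₀ hLδ]
    have e : δ ^ q = δ ^ (q / 2) * δ ^ (q / 2) := by
      rw [← Real.rpow_add hδ]; congr 1; ring
    have e2 : δ ^ (q / 2) * δ ^ (-(q / 2)) = 1 := by
      rw [← Real.rpow_add hδ]; simp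
    have hp : 0 < δ ^ (q / 2) := by positivity
    have h6 : L X * δ ^ (q / 2) ≤ 2 * Real.exp 1 * L (1 / δ) := by
      calc L X * δ ^ (q / 2) ≤ Real.exp 1 * L (1 / δ) * (2 * δ ^ (-(q / 2))) * δ ^ (q / 2) :=
            mul_le_mul_of_nonneg_right h5 hp.le
        _ = 2 * Real.exp 1 * L (1 / δ) * (δ ^ (q / 2) * δ ^ (-(q / 2))) := by ring
        _ = _ := by rw [e2, mul_one]
    have h7 : δ ^ (q / 2) ≤ 2 * Real.exp 1 / L X * L (1 / δ) := by
      rw [div_mul_eq_mul_div, le_div_iff₀ hLX]; linarith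
    rw [e]
    nlinarith

/-- Pointwise limit of the normalized leading term. -/
theorem ratio_tendsto (κ : ℝ) (hκ : κ ∈ Set.Ioo (0:ℝ) 1) (L : ℝ → ℝ)
    (hslow : ∀ u : ℝ, 0 < u → Tendsto (fun x : ℝ => L (u * x) / L x) atTop (𝓝 1))
    (r : ℝ) (hr : 0 < r) :
    Tendsto (fun δ : ℝ => (1 - theta κ (δ * r)) * (L (1 / (δ * r)) / L (1 / δ)))
      (𝓝[>] 0) (𝓝 1) := by
  have h1 : Tendsto (fun δ : ℝ => δ * r) (𝓝[>] 0) (𝓝[>] 0) := by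
    rw [tendsto_nhdsWithin_iff]
    constructor
    · have : Tendsto (fun δ : ℝ => δ * r) (𝓝 0) (𝓝 (0 * r)) := by
        exact (continuous_id.mul continuous_const).tendsto 0
      rw [zero_mul] at this
      exact this.mono_left nhdsWithin_le_nhds
    · filter_upwards [self_mem_nhdsWithin] with δ hδ
      exact mul_pos hδ hr
  have h2 := (theta_tendsto κ hκ).comp h1
  have h3 := (hslow (1 / r) (by positivity)).comp tendsto_inv_nhdsGT_zero
  have h4 := h2.mul h3
  rw [mul_one] at h4
  refine h4.congr fun δ => ?_
  simp only [Function.comp]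
  congr 3
  · rw [one_div, one_div, mul_inv, mul_comm]
  · rw [one_div]

theorem sq_le_powB (α K P r : ℝ) (hK : 0 ≤ K) (hr : 0 < r) (h0 : 0 ≤ P) (h1 : P ≤ 1)
    (h2 : r ^ α * P ≤ K) : P ^ 2 ≤ (1 + K ^ 2) * powB 0 (-(2 * α)) r := by
  unfold powB
  split_ifs with h
  · rw [Real.rpow_zero]
    nlinarith [sq_nonneg K]
  · have hp : 0 < r ^ α := by positivity
    have e : r ^ (-(2 * α)) = ((r ^ α) ^ 2)⁻¹ := by
      rw [Real.rpow_neg hr.le, mul_comm, Real.rpow_mul hr.le]; norm_cast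
    rw [e, ← div_eq_mul_inv, le_div_iff₀ (by positivity)]
    have h3 : 0 ≤ r ^ α * P := by positivity
    nlinarith

theorem powB_mul (a b c d r : ℝ) (hr : 0 < r) :
    powB a b r * powB c d r = powB (a + c) (b + d) r := by
  unfold powB
  split_ifs <;> rw [← Real.rpow_add hr]

theorem powB_self (a r : ℝ) : powB a a r = r ^ a := by
  unfold powB
  split_ifs <;> rfl

theorem lead_bound (κ η α K C P E R r : ℝ) (hη : 0 < η) (hK : 0 ≤ K) (hC : 0 ≤ C) (hr : 0 < r)
    (hP0 : 0 ≤ P) (hP1 : P ≤ 1) (hP2 : r ^ α * P ≤ K)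
    (hE0 : 0 ≤ E) (hE1 : E ≤ 1) (hE2 : r ^ α * E ≤ K) (hR0 : 0 ≤ R)
    (hR : R ≤ C * (r ^ η + r ^ (-η))) :
    r ^ (κ - 1) * (P * Real.sqrt R - E) ^ 2 ≤
      (4 * C + 2) * (1 + K ^ 2) * powB (κ - 1 - η) (κ - 1 + η - 2 * α) r := by
  have hPs := sq_le_powB α K P r hK hr hP0 hP1 hP2
  have hEs := sq_le_powB α K E r hK hr hE0 hE1 hE2
  have hb0 := powB_nonneg 0 (-(2 * α)) r hr.le
  have hW : r ^ η + r ^ (-η) ≤ 2 * powB (-η) η r ∧ 1 ≤ powB (-η) η r := by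
    unfold powB
    split_ifs with h
    · have a1 : r ^ η ≤ 1 := Real.rpow_le_one hr.le h hη.le
      have a2 : 1 ≤ r ^ (-η) := Real.one_le_rpow_of_pos_of_le_one_of_nonpos hr h (by linarith)
      constructor <;> linarith
    · push Not at h
      have a1 : 1 ≤ r ^ η := Real.one_le_rpow h.le hη.le
      have a2 : r ^ (-η) ≤ 1 := Real.rpow_le_one_of_one_le_of_nonpos h.le (by linarith)
      constructor <;> linarith
  set B := (1 + K ^ 2) * powB 0 (-(2 * α)) r with hB
  set W := powB (-η) η r with hWd
  have hB0 : 0 ≤ B := by positivity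
  have hsq : Real.sqrt R ^ 2 = R := Real.sq_sqrt hR0
  have hRW : R ≤ 2 * C * W := hR.trans (by nlinarith [hW.1])
  have h1 : P ^ 2 * R ≤ B * (2 * C * W) := mul_le_mul hPs hRW hR0 hB0
  have h2 : E ^ 2 ≤ B * W := hEs.trans (by nlinarith [hW.2])
  have h3 : (P * Real.sqrt R - E) ^ 2 ≤ (4 * C + 2) * (B * W) := by
    have : (P * Real.sqrt R - E) ^ 2 ≤ 2 * (P ^ 2 * R) + 2 * E ^ 2 := by
      have e : P ^ 2 * R = (P * Real.sqrt R) ^ 2 := by rw [mul_pow, hsq]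
      rw [e]; nlinarith [sq_nonneg (P * Real.sqrt R + E)]
    nlinarith
  have e : powB (κ - 1 - η) (κ - 1 + η - 2 * α) r =
      r ^ (κ - 1) * (powB 0 (-(2 * α)) r * W) := by
    rw [← powB_self, hWd, powB_mul _ _ _ _ _ hr, powB_mul _ _ _ _ _ hr]
    congr 1 <;> ring
  calc _ ≤ r ^ (κ - 1) * ((4 * C + 2) * (B * W)) := mul_le_mul_of_nonneg_left h3 (by positivity)
    _ = _ := by rw [e, hB]; ring

/-- The normalized leading ratio. -/
noncomputable def ratR (κ : ℝ) (L : ℝ → ℝ) (δ r : ℝ) : ℝ :=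
  (1 - theta κ (δ * r)) * (L (1 / (δ * r)) / L (1 / δ))

theorem lead_tendsto (κ : ℝ) (hκ : κ ∈ Set.Ioo (0:ℝ) 1) (L : ℝ → ℝ) (hm : Measurable L)
    (hpos : ∀ x : ℝ, 0 < x → 0 < L x)
    (hslow : ∀ u : ℝ, 0 < u → Tendsto (fun x : ℝ => L (u * x) / L x) atTop (𝓝 1))
    (hb : ∀ b : ℝ, 0 < b → ∃ C : ℝ, ∀ x ∈ Set.Ioc (0 : ℝ) b, L x ≤ C)
    (α : ℝ) (hα : κ / 2 < α) (P : ℝ → ℝ → ℝ) (E : ℝ → ℝ) (K : ℝ) (hK : 0 ≤ K)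
    (hPm : ∀ δ, Measurable (P δ)) (hEm : Measurable E)
    (hP : ∀ δ x, 0 ≤ P δ x ∧ P δ x ≤ 1 ∧ |x| ^ α * P δ x ≤ K)
    (hE : ∀ x, 0 ≤ E x ∧ E x ≤ 1 ∧ |x| ^ α * E x ≤ K)
    (hlim : ∀ x, Tendsto (fun δ => P δ x) (𝓝[>] 0) (𝓝 (E x))) :
    (∀ᶠ δ in 𝓝[>] (0:ℝ), Integrable
      (fun x : ℝ => |x| ^ (κ - 1) * (P δ x * Real.sqrt (ratR κ L δ |x|) - E x) ^ 2)) ∧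
    Tendsto (fun δ => ∫ x : ℝ, |x| ^ (κ - 1) * (P δ x * Real.sqrt (ratR κ L δ |x|) - E x) ^ 2)
      (𝓝[>] 0) (𝓝 0) := by
  obtain ⟨hκ0, hκ1⟩ := hκ
  set η := min κ (2 * α - κ) / 2 with hη
  have hm0 : 0 < min κ (2 * α - κ) := lt_min hκ0 (by linarith)
  have hη0 : 0 < η := by positivity
  have hη1 : η ≤ κ / 2 := by have := min_le_left κ (2 * α - κ); linarith
  have hη2 : η ≤ (2 * α - κ) / 2 := by have := min_le_right κ (2 * α - κ); linarith
  obtain ⟨δ₀, C, hδ₀, hC, hbd⟩ := sv_ratio_bound L hm hpos hslow hb η hη0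
  set bound : ℝ → ℝ := fun x =>
    (4 * C + 2) * (1 + K ^ 2) * powB (κ - 1 - η) (κ - 1 + η - 2 * α) |x| with hbound
  have hbi : Integrable bound :=
    (powB_integrable _ _ (by linarith) (by linarith)).const_mul _
  have hne : ∀ᵐ x : ℝ, x ≠ 0 := by simp [ae_iff, measure_singleton]
  have hmeas : ∀ δ, AEStronglyMeasurable
      (fun x : ℝ => |x| ^ (κ - 1) * (P δ x * Real.sqrt (ratR κ L δ |x|) - E x) ^ 2) := by
    intro δ
    have h1 := hPm δ
    have h2 := theta_measurable κ
    have : Measurable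
      (fun x : ℝ => |x| ^ (κ - 1) * (P δ x * Real.sqrt (ratR κ L δ |x|) - E x) ^ 2) := by
      unfold ratR
      fun_prop
    exact this.aestronglyMeasurable
  have hdom : ∀ᶠ δ in 𝓝[>] (0:ℝ), ∀ᵐ x : ℝ,
      ‖|x| ^ (κ - 1) * (P δ x * Real.sqrt (ratR κ L δ |x|) - E x) ^ 2‖ ≤ bound x := by
    filter_upwards [Ioo_mem_nhdsGT hδ₀] with δ hδ
    filter_upwards [hne] with x hx
    have hx0 : 0 < |x| := abs_pos.2 hx
    have hδ0 : 0 < δ := hδ.1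
    rw [Real.norm_of_nonneg (by positivity)]
    obtain ⟨p0, p1, p2⟩ := hP δ x
    obtain ⟨e0, e1, e2⟩ := hE x
    obtain ⟨t0, t1⟩ := theta_bounds κ ⟨hκ0, hκ1⟩ (δ * |x|) (by positivity)
    have l1 := hpos (1 / (δ * |x|)) (by positivity)
    have l2 := hpos (1 / δ) (by positivity)
    have l3 : 0 ≤ L (1 / (δ * |x|)) / L (1 / δ) := by positivity
    apply lead_bound κ η α K C (P δ x) (E x) _ |x| hη0 hK hC hx0 p0 p1 p2 e0 e1 e2
    · exact mul_nonneg t0 l3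
    · exact (mul_le_of_le_one_left l3 t1).trans (hbd δ |x| hδ.1 hδ.2 hx0)
  refine ⟨?_, ?_⟩
  · filter_upwards [hdom] with δ hδ
    exact hbi.mono' (hmeas δ) hδ
  · have hz : ∫ x : ℝ, (0:ℝ) = 0 := by simp
    have hgoal : Tendsto (fun δ => ∫ x : ℝ,
        |x| ^ (κ - 1) * (P δ x * Real.sqrt (ratR κ L δ |x|) - E x) ^ 2)
        (𝓝[>] 0) (𝓝 (∫ x : ℝ, (0:ℝ))) := ?_
    · rwa [hz] at hgoal
    refine tendsto_integral_filter_of_dominated_convergence bound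
      (Eventually.of_forall hmeas) hdom hbi ?_
    filter_upwards [hne] with x hx
    have hx0 : 0 < |x| := abs_pos.2 hx
    have h1 : Tendsto (fun δ => ratR κ L δ |x|) (𝓝[>] 0) (𝓝 1) :=
      ratio_tendsto κ ⟨hκ0, hκ1⟩ L hslow |x| hx0
    have h2 := (((hlim x).mul h1.sqrt).sub (tendsto_const_nhds (x := E x))).pow 2
    have h3 := h2.const_mul (|x| ^ (κ - 1))
    simpa using h3

theorem specG_nonneg_all (κ : ℝ) (hκ : κ ∈ Set.Ioo (0:ℝ) 1) (L : ℝ → ℝ)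
    (hpos : ∀ x : ℝ, 0 < x → 0 < L x) (r : ℝ) (hr : 0 ≤ r) : 0 ≤ specG κ L r := by
  rcases hr.eq_or_lt with h | h
  · unfold specG
    rw [← h, Real.zero_rpow (by linarith [hκ.2]), div_zero]
  · exact specG_nonneg κ hκ L hpos r h

theorem ptwise_bound (P E s a b q : ℝ) (ha : 0 ≤ a) (hb : 0 ≤ b)
    (hs : 0 ≤ s) (hq : s * Real.sqrt a = q) (F : ℝ) :
    (P * s * Real.sqrt (a + b) - F) ^ 2 ≤ 2 * (P * q - F) ^ 2 + 2 * (P ^ 2 * s ^ 2 * b) := by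
  have h1 : (Real.sqrt (a + b) - Real.sqrt a) ^ 2 ≤ b := by
    have e1 := Real.sq_sqrt ha
    have e2 := Real.sq_sqrt (add_nonneg ha hb)
    have h3 : Real.sqrt a ≤ Real.sqrt (a + b) := Real.sqrt_le_sqrt (by linarith)
    nlinarith [Real.sqrt_nonneg a]
  have h2 := mul_le_mul_of_nonneg_left h1 (by positivity : 0 ≤ P ^ 2 * s ^ 2)
  rw [← hq]
  nlinarith [sq_nonneg ((P * (s * Real.sqrt a) - F) -
    P * s * (Real.sqrt (a + b) - Real.sqrt a))]

theorem main_delta (κ : ℝ) (hκ : κ ∈ Set.Ioo (0:ℝ) 1) (L : ℝ → ℝ) (hm : Measurable L)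
    (hpos : ∀ x : ℝ, 0 < x → 0 < L x)
    (hslow : ∀ u : ℝ, 0 < u → Tendsto (fun x : ℝ => L (u * x) / L x) atTop (𝓝 1))
    (hb : ∀ b : ℝ, 0 < b → ∃ C : ℝ, ∀ x ∈ Set.Ioc (0 : ℝ) b, L x ≤ C)
    (α : ℝ) (hα : κ / 2 < α) (P : ℝ → ℝ → ℝ) (E : ℝ → ℝ) (K : ℝ) (hK : 0 ≤ K)
    (hPm : ∀ δ, Measurable (P δ)) (hEm : Measurable E)
    (hP : ∀ δ x, 0 ≤ P δ x ∧ P δ x ≤ 1 ∧ |x| ^ α * P δ x ≤ K)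
    (hE : ∀ x, 0 ≤ E x ∧ E x ≤ 1 ∧ |x| ^ α * E x ≤ K)
    (hlim : ∀ x, Tendsto (fun δ => P δ x) (𝓝[>] 0) (𝓝 (E x)))
    (c p : ℝ) (hc : 0 ≤ c) (hp : κ < p) (hpα : p < 2 * α) (rr : ℝ → ℝ) (hrr : ∀ x, 0 ≤ rr x)
    (hitg : Integrable (fun x : ℝ => |x| ^ (-p) * rr x)) :
    Tendsto (fun δ : ℝ => ∫ x : ℝ, (P δ x * δ ^ ((1 - κ) / 2) *
      Real.sqrt ((c * specG κ L |δ * x| + rr (δ * x)) / L (1 / δ)) -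
      Real.sqrt c * E x * |x| ^ ((κ - 1) / 2)) ^ 2) (𝓝[>] 0) (𝓝 0) := by
  obtain ⟨hI, hT⟩ := lead_tendsto κ hκ L hm hpos hslow hb α hα P E K hK hPm hEm hP hE hlim
  have hS := sv_inv_bound L hm hpos hslow (p - κ) (by linarith)
  set J := ∫ x : ℝ, |x| ^ (-p) * rr x with hJ
  have hlim2 := (hT.const_mul (2 * c)).add (hS.const_mul (2 * (1 + K ^ 2) * J))
  rw [mul_zero, mul_zero, add_zero] at hlim2
  have hne : ∀ᵐ x : ℝ, x ≠ 0 := by simp [ae_iff, measure_singleton]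
  refine squeeze_zero' (Eventually.of_forall fun δ => integral_nonneg fun x => sq_nonneg _) ?_ hlim2
  filter_upwards [hI, self_mem_nhdsWithin] with δ hIδ hδ
  have hδ : 0 < δ := hδ
  have hLδ := hpos (1 / δ) (by positivity)
  have hi2 : Integrable (fun x : ℝ => |δ * x| ^ (-p) * rr (δ * x)) :=
    hitg.comp_mul_left' hδ.ne'
  have hJ2 : ∫ x : ℝ, |δ * x| ^ (-p) * rr (δ * x) = δ⁻¹ * J := by
    have := Measure.integral_comp_mul_left (fun x : ℝ => |x| ^ (-p) * rr x) δ
    rw [this, abs_of_pos (by positivity), smul_eq_mul]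
  set Z := 2 * (1 + K ^ 2) * (δ ^ (p - κ + 1) / L (1 / δ)) with hZ
  have key : ∫ x : ℝ, (P δ x * δ ^ ((1 - κ) / 2) *
      Real.sqrt ((c * specG κ L |δ * x| + rr (δ * x)) / L (1 / δ)) -
      Real.sqrt c * E x * |x| ^ ((κ - 1) / 2)) ^ 2 ≤
      ∫ x : ℝ, (2 * c * (|x| ^ (κ - 1) * (P δ x * Real.sqrt (ratR κ L δ |x|) - E x) ^ 2) +
        Z * (|δ * x| ^ (-p) * rr (δ * x))) := by
    refine integral_mono_of_nonneg (Eventually.of_forall fun x => sq_nonneg _)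
      ((hIδ.const_mul _).add (hi2.const_mul _)) ?_
    filter_upwards [hne] with x hx
    have hx0 : 0 < |x| := abs_pos.2 hx
    have hδx : |δ * x| = δ * |x| := by rw [abs_mul, abs_of_pos hδ]
    have hG := specG_nonneg_all κ hκ L hpos |δ * x| (abs_nonneg _)
    obtain ⟨p0, p1, p2⟩ := hP δ x
    have hPs := sq_le_powB α K (P δ x) |x| hK hx0 p0 p1 p2
    have hPp : P δ x ^ 2 ≤ (1 + K ^ 2) * |x| ^ (-p) := by
      refine hPs.trans (mul_le_mul_of_nonneg_left ?_ (by positivity))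
      unfold powB
      split_ifs with h
      · rw [Real.rpow_zero]
        exact Real.one_le_rpow_of_pos_of_le_one_of_nonpos hx0 h (by linarith [hκ.1])
      · push Not at h
        exact Real.rpow_le_rpow_of_exponent_le h.le (by linarith)
    set s := δ ^ ((1 - κ) / 2) with hs
    have hs0 : 0 < s := by positivity
    have hs2 : s ^ 2 = δ ^ (1 - κ) := by
      rw [hs, ← Real.rpow_natCast, ← Real.rpow_mul hδ.le]; congr 1; push_cast; ring
    have hxs : (|x| ^ ((κ - 1) / 2)) ^ 2 = |x| ^ (κ - 1) := by
      rw [← Real.rpow_natCast, ← Real.rpow_mul hx0.le]; congr 1; push_cast; ring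
    have hsq : s * Real.sqrt (c * specG κ L |δ * x| / L (1 / δ)) =
        Real.sqrt c * |x| ^ ((κ - 1) / 2) * Real.sqrt (ratR κ L δ |x|) := by
      have e1 : s = Real.sqrt (δ ^ (1 - κ)) := by
        rw [← hs2, Real.sqrt_sq hs0.le]
      have e2 : |x| ^ ((κ - 1) / 2) = Real.sqrt (|x| ^ (κ - 1)) := by
        rw [← hxs, Real.sqrt_sq (by positivity)]
      rw [e1, e2, ← Real.sqrt_mul (by positivity), ← Real.sqrt_mul hc,
        ← Real.sqrt_mul (by positivity)]
      congr 1
      unfold specG ratR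
      rw [hδx, Real.mul_rpow hδ.le hx0.le]
      have e3 : |x| ^ (κ - 1) = (|x| ^ (1 - κ))⁻¹ := by
        rw [← Real.rpow_neg hx0.le]; congr 1; ring
      rw [e3]
      have f1 : δ ^ (1 - κ) ≠ 0 := by positivity
      have f2 : |x| ^ (1 - κ) ≠ 0 := by positivity
      field_simp
    have hrx := hrr (δ * x)
    have hpt := ptwise_bound (P δ x) (E x) s (c * specG κ L |δ * x| / L (1 / δ))
      (rr (δ * x) / L (1 / δ)) _ (by positivity) (by positivity) hs0.le hsq
      (Real.sqrt c * E x * |x| ^ ((κ - 1) / 2))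
    rw [← add_div] at hpt
    refine hpt.trans (add_le_add (le_of_eq ?_) ?_)
    · rw [← hxs]
      have := Real.sq_sqrt hc
      calc _ = 2 * (Real.sqrt c) ^ 2 * ((|x| ^ ((κ - 1) / 2)) ^ 2 *
            (P δ x * Real.sqrt (ratR κ L δ |x|) - E x) ^ 2) := by ring
        _ = _ := by rw [this]
    · have e4 : δ ^ (p - κ + 1) * |δ * x| ^ (-p) = δ ^ (1 - κ) * |x| ^ (-p) := by
        rw [hδx, Real.mul_rpow hδ.le hx0.le, ← mul_assoc, ← Real.rpow_add hδ]
        congr 2; ring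
      have e5 : Z * (|δ * x| ^ (-p) * rr (δ * x)) =
          2 * (((1 + K ^ 2) * |x| ^ (-p)) * δ ^ (1 - κ) * (rr (δ * x) / L (1 / δ))) := by
        calc _ = 2 * (1 + K ^ 2) * (δ ^ (p - κ + 1) * |δ * x| ^ (-p)) *
              (rr (δ * x) / L (1 / δ)) := by rw [hZ]; ring
          _ = _ := by rw [e4]; ring
      rw [e5, hs2]
      gcongr
  refine key.trans (le_of_eq ?_)
  rw [integral_add (hIδ.const_mul _) (hi2.const_mul _), integral_const_mul, integral_const_mul,
    hJ2, hZ, Real.rpow_add hδ, Real.rpow_one]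
  congr 1
  field_simp
/-- Analytic core of Theorem 4.1: with `A₀ > 0`, `α > κ₀/2`, and slowly varying factors
`L_0,…,L_n`, the mean-square distance
`∫_ℝ (E_β(−μ|λ|^α(1+λ²ε^{2β/α})^{γ/2} t^β) ε^{(1−κ₀)β/(2α)} √(f^{(L)}(ε^{β/α}λ)/L_0(ε^{−β/α}))
  − √(A₀/(2Γ(κ₀)cos(πκ₀/2))) E_β(−μ t^β |λ|^α)|λ|^{(κ₀−1)/2})² dλ`
tends to `0` as `ε → 0⁺`. -/
theorem mean_square_limit_slowly_varying (n : ℕ) (hn : 1 ≤ n) (w κ A : ℕ → ℝ)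
    (hw0 : w 0 = 0) (hw : ∀ j ∈ Finset.Icc 1 n, 0 < w j)
    (hκ : ∀ j ∈ Finset.range (n + 1), κ j ∈ Set.Ioo (0 : ℝ) 1)
    (hA : ∀ j ∈ Finset.range (n + 1), 0 ≤ A j)
    (hAsum : ∑ j ∈ Finset.range (n + 1), A j = 1) (hA0 : 0 < A 0)
    (L : ℕ → ℝ → ℝ)
    (hLmeas : ∀ j ∈ Finset.range (n + 1), Measurable (L j))
    (hLpos : ∀ j ∈ Finset.range (n + 1), ∀ x : ℝ, 0 < x → 0 < L j x)
    (hLslow : ∀ j ∈ Finset.range (n + 1), ∀ u : ℝ, 0 < u →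
      Filter.Tendsto (fun x : ℝ => L j (u * x) / L j x) Filter.atTop (𝓝 1))
    (hLbdd : ∀ j ∈ Finset.range (n + 1), ∀ b : ℝ, 0 < b →
      ∃ C : ℝ, ∀ x ∈ Set.Ioc (0 : ℝ) b, L j x ≤ C)
    (β α γ μ t : ℝ) (hβ : β ∈ Set.Ioo (0 : ℝ) 1) (hα : κ 0 / 2 < α) (hγ : 0 < γ)
    (hμ : 0 < μ) (ht : 0 < t) :
    Filter.Tendsto
      (fun ε : ℝ =>
        ∫ lam : ℝ,
          (mittagLeffler β
              (-(μ * |lam| ^ α * (1 + lam ^ 2 * ε ^ (2 * β / α)) ^ (γ / 2) * t ^ β)) *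
            ε ^ ((1 - κ 0) * β / (2 * α)) *
            Real.sqrt (specDensityL n w κ A L (ε ^ (β / α) * lam) /
              L 0 (ε ^ (-(β / α)))) -
          Real.sqrt (A 0 / (2 * Real.Gamma (κ 0) * Real.cos (Real.pi * κ 0 / 2))) *
            mittagLeffler β (-(μ * t ^ β * |lam| ^ α)) * |lam| ^ ((κ 0 - 1) / 2)) ^ 2)
      (𝓝[>] (0 : ℝ)) (𝓝 0) := by
  have hmem : ∀ j ∈ Finset.Icc (-(n : ℤ)) (n : ℤ), j.natAbs ∈ Finset.range (n + 1) := by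
    intro j hj
    rw [Finset.mem_Icc] at hj
    rw [Finset.mem_range]
    omega
  have h0r : 0 ∈ Finset.range (n + 1) := Finset.mem_range.2 (by omega)
  have hκ0 := hκ 0 h0r
  obtain ⟨hk0, hk1⟩ := hκ0
  have hα0 : 0 < α := by linarith
  have hβ0 := hβ.1
  have htβ : 0 < t ^ β := by positivity
  have hcos : ∀ k : ℝ, k ∈ Set.Ioo (0:ℝ) 1 → 0 < Real.cos (Real.pi * k / 2) := by
    intro k hk
    apply Real.cos_pos_of_mem_Ioo
    have := Real.pi_pos
    constructor <;> nlinarith [hk.1, hk.2]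
  have hcT : ∀ j ∈ Finset.Icc (-(n : ℤ)) (n : ℤ), 0 ≤ cTwo κ j / 2 * A j.natAbs := by
    intro j hj
    have h1 := hmem j hj
    have h2 := hA _ h1
    have h3 := hcos _ (hκ _ h1)
    have h4 := Real.Gamma_pos_of_pos (hκ _ h1).1
    have h5 := hcos _ (hκ 0 h0r)
    have h6 := Real.Gamma_pos_of_pos hk0
    unfold cTwo
    split_ifs <;> positivity
  set c := A 0 / (2 * Real.Gamma (κ 0) * Real.cos (Real.pi * κ 0 / 2)) with hc
  have hc0 : 0 ≤ c := by
    have h5 := hcos _ (hκ 0 h0r)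
    have h6 := Real.Gamma_pos_of_pos hk0
    positivity
  obtain ⟨p, hp1, hp2⟩ := exists_between (lt_min hk1 (by linarith : κ 0 < 2 * α))
  have hpα : p < 2 * α := hp2.trans_le (min_le_right _ _)
  have hp01 : p ∈ Set.Ioo (0:ℝ) 1 := ⟨by linarith, hp2.trans_le (min_le_left _ _)⟩
  set S := (Finset.Icc (-(n : ℤ)) (n : ℤ)).erase 0 with hS
  set rr : ℝ → ℝ := fun x => ∑ j ∈ S,
    cTwo κ j / 2 * A j.natAbs * specG (κ j.natAbs) (L j.natAbs) |x + wSigned w j| with hrrdef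
  have hrr : ∀ x, 0 ≤ rr x := by
    intro x
    refine Finset.sum_nonneg fun j hj => ?_
    have hj' := Finset.mem_of_mem_erase hj
    exact mul_nonneg (hcT j hj')
      (specG_nonneg_all _ (hκ _ (hmem j hj')) _ (hLpos _ (hmem j hj')) _ (abs_nonneg _))
  have hitg : Integrable (fun x : ℝ => |x| ^ (-p) * rr x) := by
    have e : (fun x : ℝ => |x| ^ (-p) * rr x) = fun x => ∑ j ∈ S,
        cTwo κ j / 2 * A j.natAbs *
          (|x| ^ (-p) * specG (κ j.natAbs) (L j.natAbs) |x + wSigned w j|) := by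
      funext x
      rw [hrrdef, Finset.mul_sum]
      exact Finset.sum_congr rfl fun j _ => by ring
    rw [e]
    refine integrable_finset_sum _ fun j hj => ?_
    have hj' := Finset.mem_of_mem_erase hj
    have hj0 := Finset.ne_of_mem_erase hj
    have hr := hmem j hj'
    refine (rem_integrable _ (hκ _ hr) _ (hLmeas _ hr) (hLpos _ hr) (hLslow _ hr) (hLbdd _ hr)
      _ ?_ p hp01).const_mul _
    unfold wSigned
    have hwp : 0 < w j.natAbs := hw _ (by
      rw [Finset.mem_Icc]
      rw [Finset.mem_range] at hr
      omega)
    have hsg : (j.sign : ℝ) ≠ 0 := by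
      rw [Int.cast_ne_zero, Ne, Int.sign_eq_zero_iff_zero]
      exact hj0
    exact mul_ne_zero hsg hwp.ne'
  have hf : ∀ x, specDensityL n w κ A L x = c * specG (κ 0) (L 0) |x| + rr x := by
    intro x
    unfold specDensityL
    rw [← Finset.add_sum_erase _ _ (Finset.mem_Icc.2 ⟨by omega, by omega⟩ :
      (0:ℤ) ∈ Finset.Icc (-(n : ℤ)) (n : ℤ))]
    congr 1
    · simp only [wSigned, cTwo, specG, hc, Int.natAbs_zero, Int.sign_zero, Int.cast_zero, zero_mul,
        add_zero, if_true]
      ring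
    · refine Finset.sum_congr rfl fun j _ => ?_
      unfold specG
      ring
  set P : ℝ → ℝ → ℝ := fun δ x => mittagLeffler β
    (-(μ * |x| ^ α * (1 + x ^ 2 * δ ^ 2) ^ (γ / 2) * t ^ β)) with hP
  set E : ℝ → ℝ := fun x => mittagLeffler β (-(μ * t ^ β * |x| ^ α)) with hE
  have hmlc := ml_continuous β hβ0
  have hΓβ := Real.Gamma_pos_of_pos hβ0
  have hPb : ∀ δ x, 0 ≤ P δ x ∧ P δ x ≤ 1 ∧
      |x| ^ α * P δ x ≤ Real.Gamma β * β / (μ * t ^ β) := by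
    intro δ x
    have hone : 1 ≤ (1 + x ^ 2 * δ ^ 2) ^ (γ / 2) :=
      Real.one_le_rpow (by nlinarith [sq_nonneg (x * δ)]) (by positivity)
    obtain ⟨a1, a2, a3⟩ := ml_bounds β hβ
      (μ * |x| ^ α * (1 + x ^ 2 * δ ^ 2) ^ (γ / 2) * t ^ β) (by positivity)
    refine ⟨a1, a2, ?_⟩
    rw [le_div_iff₀ (by positivity)]
    refine le_trans ?_ a3
    have h1 : 0 ≤ |x| ^ α * P δ x * (μ * t ^ β) :=
      mul_nonneg (mul_nonneg (by positivity) a1) (by positivity)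
    calc |x| ^ α * P δ x * (μ * t ^ β) ≤
          |x| ^ α * P δ x * (μ * t ^ β) * (1 + x ^ 2 * δ ^ 2) ^ (γ / 2) :=
          le_mul_of_one_le_right h1 hone
      _ = _ := by rw [hP]; ring
  have hEb : ∀ x, 0 ≤ E x ∧ E x ≤ 1 ∧ |x| ^ α * E x ≤ Real.Gamma β * β / (μ * t ^ β) := by
    intro x
    obtain ⟨a1, a2, a3⟩ := ml_bounds β hβ (μ * t ^ β * |x| ^ α) (by positivity)
    refine ⟨a1, a2, ?_⟩
    rw [le_div_iff₀ (by positivity)]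
    refine le_trans (le_of_eq ?_) a3
    rw [hE]; ring
  have hPm : ∀ δ, Measurable (P δ) := by
    intro δ
    have := hmlc.measurable
    simp only [hP]
    fun_prop
  have hEm : Measurable E := by
    have := hmlc.measurable
    simp only [hE]
    fun_prop
  have hlim : ∀ x, Tendsto (fun δ => P δ x) (𝓝[>] 0) (𝓝 (E x)) := by
    intro x
    have hcont : ContinuousAt (fun δ => P δ x) 0 := by
      simp only [hP]
      refine hmlc.continuousAt.comp ?_
      refine ContinuousAt.neg (ContinuousAt.mul (ContinuousAt.mul continuousAt_const ?_)
        continuousAt_const)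
      refine ContinuousAt.rpow_const (by fun_prop) (Or.inl ?_)
      simp
    have h2 := hcont.tendsto
    have e : P 0 x = E x := by
      simp only [hP, hE]
      congr 1
      simp
      ring
    rw [e] at h2
    exact h2.mono_left nhdsWithin_le_nhds
  have hmain := main_delta (κ 0) ⟨hk0, hk1⟩ (L 0) (hLmeas 0 h0r) (hLpos 0 h0r) (hLslow 0 h0r)
    (hLbdd 0 h0r) α hα P E (Real.Gamma β * β / (μ * t ^ β)) (by positivity) hPm hEm hPb hEb hlim
    c p hc0 hp1 hpα rr hrr hitg
  have hba : 0 < β / α := by positivity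
  have hδ : Tendsto (fun ε : ℝ => ε ^ (β / α)) (𝓝[>] 0) (𝓝[>] 0) := by
    rw [tendsto_nhdsWithin_iff]
    constructor
    · have h1 := (Real.continuousAt_rpow_const 0 (β / α) (Or.inr hba.le)).tendsto
      rw [Real.zero_rpow hba.ne'] at h1
      exact h1.mono_left nhdsWithin_le_nhds
    · filter_upwards [self_mem_nhdsWithin] with ε hε
      exact Real.rpow_pos_of_pos hε _
  refine (hmain.comp hδ).congr' ?_
  filter_upwards [self_mem_nhdsWithin] with ε hε
  have hε : 0 < ε := hε
  have e1 : (ε ^ (β / α)) ^ 2 = ε ^ (2 * β / α) := by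
    rw [← Real.rpow_natCast, ← Real.rpow_mul hε.le]; congr 1; push_cast; ring
  have e2 : (ε ^ (β / α)) ^ ((1 - κ 0) / 2) = ε ^ ((1 - κ 0) * β / (2 * α)) := by
    rw [← Real.rpow_mul hε.le]; congr 1; field_simp
  have e3 : 1 / ε ^ (β / α) = ε ^ (-(β / α)) := by
    rw [Real.rpow_neg hε.le, one_div]
  simp only [Function.comp, hP, hE, hf, e1, e2, e3]
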